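/- arXiv:1612.01508 — 2 statements merged into one kernel-verified Lean document; each statement's English description precedes it below -/
import Mathlib

section
/- Let U⊂ℝ^{n_u} and V⊂ℝ^{n_v} be nonempty convex compact sets, A a d×n_u real matrix, a∈ℝ^d, v↦M(v) an affine map from ℝ^{n_v} to S^d with M(v)≻0 for all v∈V, g∈ℝ^{n_u}, K a positive integer, and 0<ε<1/2. Let Opt = min_{f∈ℝ^d}{ (1/2)(φ_U(Aᵀf−g) + φ_U(−Aᵀf+g)) + max_{v∈V} √(2K^{−1}ln(2/ε)·fᵀM(v)f) }, where φ_U(h) = max_{u∈U} uᵀh. Let Risk^opt_ε be the infimum, over all Borel functions ĝ:ℝ^{Kd}→ℝ, of the smallest ρ such that for every (u,v)∈U×V and every Borel probability distribution P on ℝ^d that is sub-Gaussian with parameters (Au+a, M(v)), one has Prob_{ω^K∼P^K}{ |ĝ(ω^K) − gᵀu| > ρ } ≤ ε. Then Opt ≤ (√(2 ln(2/ε)) / q_N(1−ε)) · Risk^opt_ε, where q_N(s) is the s-quantile of the standard normal distribution. -/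
open Matrix MeasureTheory Real

noncomputable section

/-- `P` is sub-Gaussian with parameters `(θ,Θ)`. -/
def SubGaussianWith {d : ℕ} (θ : Fin d → ℝ) (Θ : Matrix (Fin d) (Fin d) ℝ)
    (P : Measure (Fin d → ℝ)) : Prop :=
  ∀ h : Fin d → ℝ, ∫⁻ ω, ENNReal.ofReal (Real.exp (h ⬝ᵥ ω)) ∂P
    ≤ ENNReal.ofReal (Real.exp (h ⬝ᵥ θ + (1/2) * (h ⬝ᵥ Θ.mulVec h)))

/-- Support function `φ_U(h) = max_{u∈U} uᵀh`. -/
def phiSupp {n : ℕ} (U : Set (Fin n → ℝ)) (h : Fin n → ℝ) : ℝ :=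
  sSup ((fun u => u ⬝ᵥ h) '' U)

open ProbabilityTheory
open scoped ENNReal NNReal

lemma exists_forall_le_of_forall_exists_le {E F : Type*}
    [TopologicalSpace E] [AddCommGroup E] [Module ℝ E] [IsTopologicalAddGroup E]
    [ContinuousSMul ℝ E] [TopologicalSpace F] [AddCommGroup F] [Module ℝ F]
    [IsTopologicalAddGroup F] [ContinuousSMul ℝ F]
    {X : Set E} (hne : X.Nonempty) (hconv : Convex ℝ X) (hcpt : IsCompact X) {G : E → F → ℝ}
    (hGx : ∀ y, ContinuousOn (fun x => G x y) X) (hGx' : ∀ y, ConcaveOn ℝ X (fun x => G x y))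
    (hGy : ∀ x ∈ X, Continuous (G x)) (hGy' : ∀ x ∈ X, ConvexOn ℝ Set.univ (G x))
    {t s : ℝ} (hts : t < s) (h : ∀ y, ∃ x ∈ X, s ≤ G x y) :
    ∃ x ∈ X, ∀ y, t ≤ G x y := by
  by_contra! hcon
  have key := Sion.minimax' (X := X) (Y := (Set.univ : Set F))
    (f := fun x y => ((-G x y : ℝ) : EReal)) hne hconv hcpt
    (fun y _ => (continuous_coe_real_ereal.comp_continuousOn (hGx y).neg).lowerSemicontinuousOn)
    (fun y _ => (hGx' y).neg.quasiconvexOn.monotone_comp (g := Real.toEReal)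
      EReal.coe_strictMono.monotone) convex_univ
    (fun x hx => (continuous_coe_real_ereal.comp_continuousOn
      (hGy x hx).neg.continuousOn).upperSemicontinuousOn)
    (fun x hx => (hGy' x hx).neg.quasiconcaveOn.monotone_comp (g := Real.toEReal)
      EReal.coe_strictMono.monotone)
  have h1 : ((-t : ℝ) : EReal) ≤ ⨅ x ∈ X, ⨆ y ∈ (Set.univ : Set F), ((-G x y : ℝ) : EReal) := by
    refine le_iInf₂ fun x hx => ?_
    obtain ⟨y, hy⟩ := hcon x hx
    refine le_trans ?_ (le_iSup₂ (f := fun y (_ : y ∈ (Set.univ : Set F)) =>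
      ((-G x y : ℝ) : EReal)) y (Set.mem_univ y))
    exact EReal.coe_le_coe_iff.2 (by linarith)
  have h2 : ⨆ y ∈ (Set.univ : Set F), ⨅ x ∈ X, ((-G x y : ℝ) : EReal) ≤ ((-s : ℝ) : EReal) := by
    refine iSup₂_le fun y _ => ?_
    obtain ⟨x, hx, hxy⟩ := h y
    exact iInf₂_le_of_le x hx (EReal.coe_le_coe_iff.2 (by linarith))
  have := EReal.coe_le_coe_iff.1 ((h1.trans key.le).trans h2)
  linarith

lemma lintegral_fintype_prod_eq_prod {ι : Type*} [Fintype ι] {Ω : ι → Type*}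
    [∀ i, MeasurableSpace (Ω i)] (μ : ∀ i, Measure (Ω i)) [∀ i, IsProbabilityMeasure (μ i)]
    {f : ∀ i, Ω i → ℝ≥0∞} (hf : ∀ i, Measurable (f i)) :
    ∫⁻ x, ∏ i, f i (x i) ∂(Measure.pi μ) = ∏ i, ∫⁻ x, f i x ∂(μ i) := by
  rw [lintegral_prod_eq_prod_lintegral_of_indepFun (μ := Measure.pi μ) Finset.univ
    (fun i x => f i (x i))
    (iIndepFun_pi fun i => (hf i).aemeasurable) (fun i => (hf i).comp (measurable_pi_apply i))]
  exact Finset.prod_congr rfl fun i _ =>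
    (measurePreserving_eval μ i).lintegral_comp (hf i)

/-- `ν` has a log-normal density `exp (T - s / 2)` with respect to `μ`, where `T` is centred
Gaussian of variance `s` under `μ`. -/
def IsGaussianShift {Ω : Type*} [MeasurableSpace Ω] (μ ν : Measure Ω) (s : ℝ≥0) : Prop :=
  ∃ T : Ω → ℝ, Measurable T ∧ μ.map T = gaussianReal 0 s ∧
    ν = μ.withDensity fun x => ENNReal.ofReal (Real.exp (T x - s / 2))

lemma gaussianReal_withDensity (δ : ℝ) :
    gaussianReal δ 1 = (gaussianReal 0 1).withDensity
      fun x => ENNReal.ofReal (Real.exp (δ * x - δ ^ 2 / 2)) := by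
  rw [gaussianReal_of_var_ne_zero _ one_ne_zero, gaussianReal_of_var_ne_zero _ one_ne_zero,
    ← withDensity_mul _ (measurable_gaussianPDF _ _) (by fun_prop)]
  congr 1
  ext x
  simp only [gaussianPDF, gaussianPDFReal, Pi.mul_apply]
  rw [← ENNReal.ofReal_mul (by positivity), mul_assoc _ (Real.exp _), ← Real.exp_add]
  congr 3
  simp
  ring

lemma isGaussianShift_gaussianReal (δ : ℝ) :
    IsGaussianShift (gaussianReal 0 1) (gaussianReal δ 1) (Real.nnabs δ ^ 2) := by
  refine ⟨fun x => δ * x, by fun_prop, ?_, ?_⟩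
  · rw [gaussianReal_map_const_mul]
    congr 1
    · simp
    · ext; simp
  · rw [gaussianReal_withDensity δ]
    simp

lemma IsGaussianShift.pi {ι : Type*} [Fintype ι] {Ω : ι → Type*} [∀ i, MeasurableSpace (Ω i)]
    {μ ν : ∀ i, Measure (Ω i)} [∀ i, IsProbabilityMeasure (μ i)] [∀ i, IsProbabilityMeasure (ν i)]
    {s : ι → ℝ≥0} (h : ∀ i, IsGaussianShift (μ i) (ν i) (s i)) :
    IsGaussianShift (Measure.pi μ) (Measure.pi ν) (∑ i, s i) := by
  choose T hT hmap hν using h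
  have hmeas : Measurable fun x : ∀ i, Ω i => ∑ i, T i (x i) :=
    Finset.measurable_sum _ fun i _ => (hT i).comp (measurable_pi_apply i)
  refine ⟨fun x => ∑ i, T i (x i), hmeas, ?_, ?_⟩
  · have := Measure.isProbabilityMeasure_map (μ := Measure.pi μ) hmeas.aemeasurable
    refine Measure.ext_of_charFun (funext fun t => ?_)
    rw [charFun_apply_real, integral_map hmeas.aemeasurable (by fun_prop)]
    have h1 : ∀ x : ∀ i, Ω i, Complex.exp (t * ((∑ i, T i (x i) : ℝ) : ℂ) * Complex.I)
        = ∏ i, Complex.exp (t * (T i (x i) : ℂ) * Complex.I) := fun x => by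
      rw [← Complex.exp_sum]; push_cast; rw [Finset.mul_sum, Finset.sum_mul]
    simp_rw [h1]
    rw [integral_fintype_prod_eq_prod (fun i x => Complex.exp (t * (T i x : ℂ) * Complex.I))]
    have h2 : ∀ i, ∫ x, Complex.exp (t * (T i x : ℂ) * Complex.I) ∂(μ i)
        = charFun (gaussianReal 0 (s i)) t := fun i => by
      rw [← hmap i, charFun_apply_real, integral_map (hT i).aemeasurable (by fun_prop)]
    simp_rw [h2, charFun_gaussianReal]
    rw [← Complex.exp_sum]
    push_cast
    simp [Finset.sum_mul, Finset.sum_div]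
  · refine Measure.pi_eq fun A hA => ?_
    rw [withDensity_apply _ (MeasurableSet.univ_pi hA), ← lintegral_indicator
      (MeasurableSet.univ_pi hA)]
    have h1 : ∀ x : ∀ i, Ω i, (Set.univ.pi A).indicator (fun x => ENNReal.ofReal
        (Real.exp (∑ i, T i (x i) - ((∑ i, s i : ℝ≥0) : ℝ) / 2))) x
        = ∏ i, (A i).indicator (fun y => ENNReal.ofReal (Real.exp (T i y - s i / 2))) (x i) := by
      intro x
      by_cases hx : x ∈ Set.univ.pi A
      · rw [Set.indicator_of_mem hx, Finset.prod_congr rfl fun i _ =>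
          Set.indicator_of_mem (hx i (Set.mem_univ i)) _, ← ENNReal.ofReal_prod_of_nonneg
          (fun i _ => (Real.exp_pos _).le), ← Real.exp_sum, Finset.sum_sub_distrib]
        push_cast
        rw [Finset.sum_div]
      · rw [Set.indicator_of_notMem hx]
        simp only [Set.mem_univ_pi, not_forall] at hx
        obtain ⟨i, hi⟩ := hx
        exact (Finset.prod_eq_zero (Finset.mem_univ i) (Set.indicator_of_notMem hi _)).symm
    simp_rw [h1]
    rw [lintegral_fintype_prod_eq_prod μ (f := fun i => (A i).indicator
      (fun y => ENNReal.ofReal (Real.exp (T i y - s i / 2)))) (fun i =>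
        Measurable.indicator (by have := hT i; fun_prop) (hA i))]
    refine Finset.prod_congr rfl fun i _ => ?_
    rw [lintegral_indicator (hA i), ← withDensity_apply _ (hA i), ← hν i]

lemma IsGaussianShift.le_add_compl {Ω : Type*} [MeasurableSpace Ω] {μ ν : Measure Ω} {s : ℝ≥0}
    (h : IsGaussianShift μ ν s) {B : Set Ω} (hB : MeasurableSet B) :
    2 * gaussianReal 0 1 (Set.Ioi (√s / 2)) ≤ μ B + ν Bᶜ := by
  obtain ⟨T, hT, hmap, rfl⟩ := h
  set σ : ℝ := √s with hσ
  have hσ2 : σ ^ 2 = s := Real.sq_sqrt s.2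
  have hmap' : μ.map T = (gaussianReal 0 1).map (fun x => σ * x) := by
    rw [hmap, gaussianReal_map_const_mul]
    congr 1
    · simp
    · ext; simp [hσ2]
  let m : ℝ → ℝ≥0∞ := fun x => min 1 (ENNReal.ofReal (Real.exp (x - s / 2)))
  have hm : Measurable m := by fun_prop
  calc 2 * gaussianReal 0 1 (Set.Ioi (σ / 2))
      ≤ ∫⁻ x, m (σ * x) ∂(gaussianReal 0 1) := by
        rw [← lintegral_add_compl _ (measurableSet_Ioi (a := σ / 2)), two_mul]
        refine add_le_add ?_ ?_
        · rw [← setLIntegral_one]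
          refine setLIntegral_mono (by fun_prop) fun x hx => le_min le_rfl ?_
          rw [ENNReal.one_le_ofReal, Real.one_le_exp_iff]
          have : σ / 2 < x := hx
          nlinarith [Real.sqrt_nonneg (s : ℝ)]
        · have h1 : gaussianReal 0 1 (Set.Ioi (σ / 2)) = gaussianReal σ 1 (Set.Iio (σ / 2)) := by
            have : gaussianReal σ 1 = (gaussianReal 0 1).map (fun x => σ - x) := by
              rw [gaussianReal_map_const_sub]; simp
            rw [this, Measure.map_apply (by fun_prop) measurableSet_Iio]
            congr 1
            ext x
            simp only [Set.mem_Ioi, Set.mem_preimage, Set.mem_Iio]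
            constructor <;> intro <;> linarith
          rw [h1, gaussianReal_withDensity, withDensity_apply _ measurableSet_Iio]
          refine (lintegral_mono_set (t := (Set.Ioi (σ / 2))ᶜ) fun x hx => ?_).trans
            (setLIntegral_mono (by fun_prop) fun x hx => le_min ?_ ?_)
          · exact not_lt.2 (Set.mem_Iio.1 hx).le
          · rw [ENNReal.ofReal_le_one, Real.exp_le_one_iff]
            have : x ≤ σ / 2 := not_lt.1 hx
            nlinarith [Real.sqrt_nonneg (s : ℝ)]
          · rw [hσ2]
    _ = ∫⁻ x, m (T x) ∂μ := by
        rw [← lintegral_map hm hT, hmap', lintegral_map hm (by fun_prop)]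
    _ ≤ _ := by
        rw [← lintegral_add_compl _ hB, withDensity_apply _ hB.compl, ← setLIntegral_one]
        exact add_le_add (lintegral_mono fun x => min_le_left _ _)
          (lintegral_mono fun x => min_le_right _ _)
/-- The law of `θ + S ξ` for a standard Gaussian vector `ξ`. -/
def gaussianLaw {d : ℕ} (θ : Fin d → ℝ) (S : Matrix (Fin d) (Fin d) ℝ) : Measure (Fin d → ℝ) :=
  (Measure.pi fun _ => gaussianReal 0 1).map fun z => θ + S *ᵥ z

lemma measurable_add_mulVec {d : ℕ} (θ : Fin d → ℝ) (S : Matrix (Fin d) (Fin d) ℝ) :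
    Measurable fun z => θ + S *ᵥ z :=
  (Continuous.add continuous_const (Continuous.matrix_mulVec continuous_const
    continuous_id)).measurable

instance {d : ℕ} (θ : Fin d → ℝ) (S : Matrix (Fin d) (Fin d) ℝ) :
    IsProbabilityMeasure (gaussianLaw θ S) :=
  Measure.isProbabilityMeasure_map (measurable_add_mulVec θ S).aemeasurable

lemma lintegral_exp_mul_gaussianReal (c : ℝ) :
    ∫⁻ x, ENNReal.ofReal (Real.exp (c * x)) ∂(gaussianReal 0 1)
      = ENNReal.ofReal (Real.exp (c ^ 2 / 2)) := by
  rw [← ofReal_integral_eq_lintegral_ofReal (integrable_exp_mul_gaussianReal c)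
    (ae_of_all _ fun x => (Real.exp_pos _).le)]
  have := congrFun (mgf_id_gaussianReal (μ := 0) (v := 1)) c
  simp only [mgf, id] at this
  rw [this]
  simp

lemma subGaussianWith_gaussianLaw {d : ℕ} (θ : Fin d → ℝ) (S : Matrix (Fin d) (Fin d) ℝ) :
    SubGaussianWith θ (S * Sᵀ) (gaussianLaw θ S) := by
  intro h
  have hm : Measurable fun ω : Fin d → ℝ => ENNReal.ofReal (Real.exp (h ⬝ᵥ ω)) := by
    simp only [dotProduct]; fun_prop
  rw [gaussianLaw, lintegral_map hm (measurable_add_mulVec θ S)]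
  set w : Fin d → ℝ := h ᵥ* S with hw
  have h1 : ∀ z : Fin d → ℝ, ENNReal.ofReal (Real.exp (h ⬝ᵥ (θ + S *ᵥ z)))
      = ENNReal.ofReal (Real.exp (h ⬝ᵥ θ)) * ∏ i, ENNReal.ofReal (Real.exp (w i * z i)) := by
    intro z
    rw [← ENNReal.ofReal_prod_of_nonneg (fun i _ => (Real.exp_pos _).le), ← Real.exp_sum,
      ← ENNReal.ofReal_mul (Real.exp_pos _).le, ← Real.exp_add, dotProduct_add,
      dotProduct_mulVec]
    rfl
  simp_rw [h1]
  rw [lintegral_const_mul _ (by fun_prop), lintegral_fintype_prod_eq_prod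
    (f := fun i x => ENNReal.ofReal (Real.exp (w i * x))) _ (fun i => by fun_prop)]
  simp_rw [lintegral_exp_mul_gaussianReal]
  rw [← ENNReal.ofReal_prod_of_nonneg (fun i _ => (Real.exp_pos _).le), ← Real.exp_sum,
      ← ENNReal.ofReal_mul (Real.exp_pos _).le, ← Real.exp_add]
  have h2 : h ⬝ᵥ (S * Sᵀ) *ᵥ h = ∑ i, w i ^ 2 := by
    rw [← mulVec_mulVec, dotProduct_mulVec, mulVec_transpose, ← hw]
    simp [dotProduct, sq]
  rw [h2, ← Finset.sum_div]
  apply le_of_eq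
  ring_nf

lemma gaussianLaw_add_mulVec {d : ℕ} (θ δ : Fin d → ℝ) (S : Matrix (Fin d) (Fin d) ℝ) :
    gaussianLaw (θ + S *ᵥ δ) S
      = (Measure.pi fun i => gaussianReal (δ i) 1).map fun z => θ + S *ᵥ z := by
  have h : (Measure.pi fun i => gaussianReal (δ i) 1)
      = (Measure.pi fun _ => gaussianReal 0 1).map fun (z : Fin d → ℝ) i => δ i + z i := by
    have h1 : ∀ i, gaussianReal (δ i) 1 = (gaussianReal 0 1).map fun x => δ i + x := fun i => by
      rw [gaussianReal_map_const_add]; simp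
    have : ∀ i, IsProbabilityMeasure ((gaussianReal 0 1).map fun x => δ i + x) := fun i => by
      rw [← h1]; infer_instance
    rw [Measure.pi_map_pi (f := fun i x => δ i + x) (fun i => by fun_prop)]
    simp_rw [h1]
  rw [h, Measure.map_map (measurable_add_mulVec θ S) (by fun_prop), gaussianLaw]
  congr 1
  ext1 z
  rw [add_assoc, ← mulVec_add]
  rfl

lemma two_mul_gaussianReal_Ioi_le {d K : ℕ} (θ δ : Fin d → ℝ) (S : Matrix (Fin d) (Fin d) ℝ)
    {B : Set (Fin K → Fin d → ℝ)} (hB : MeasurableSet B) :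
    2 * gaussianReal 0 1 (Set.Ioi (√(K * (δ ⬝ᵥ δ)) / 2))
      ≤ (Measure.pi fun _ : Fin K => gaussianLaw θ S) B
        + (Measure.pi fun _ : Fin K => gaussianLaw (θ + S *ᵥ δ) S) Bᶜ := by
  have hS := measurable_add_mulVec θ S
  have hmap : ∀ μ : Measure (Fin d → ℝ), IsProbabilityMeasure μ →
      (Measure.pi fun _ : Fin K => μ.map fun z => θ + S *ᵥ z)
        = (Measure.pi fun _ : Fin K => μ).map fun z k => θ + S *ᵥ z k := fun μ hμ => by
    have := Measure.isProbabilityMeasure_map (μ := μ) hS.aemeasurable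
    rw [Measure.pi_map_pi (f := fun _ z => θ + S *ᵥ z) (fun _ => hS.aemeasurable)]
  have hmeas : Measurable fun (z : Fin K → Fin d → ℝ) k => θ + S *ᵥ z k :=
    measurable_pi_lambda _ fun k => hS.comp (measurable_pi_apply k)
  rw [gaussianLaw_add_mulVec, gaussianLaw, hmap _ inferInstance, hmap _ inferInstance,
    Measure.map_apply hmeas hB, Measure.map_apply hmeas hB.compl]
  have key := (IsGaussianShift.pi fun _ : Fin K => IsGaussianShift.pi fun i : Fin d =>
    isGaussianShift_gaussianReal (δ i)).le_add_compl (hmeas hB)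
  rw [Set.preimage_compl]
  convert key using 6
  simp [dotProduct, sq]

open scoped MatrixOrder in
lemma Matrix.PosDef.exists_isUnit_mul_transpose {d : ℕ} {Q : Matrix (Fin d) (Fin d) ℝ}
    (hQ : Q.PosDef) : ∃ S : Matrix (Fin d) (Fin d) ℝ, IsUnit S ∧ Q = S * Sᵀ := by
  obtain ⟨y, hy⟩ := CStarAlgebra.nonneg_iff_eq_star_mul_self.mp hQ.posSemidef.nonneg
  have h : Q = yᵀ * y := by simpa [star_eq_conjTranspose] using hy
  refine ⟨yᵀ, ?_, by simpa using h⟩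
  have := hQ.isUnit
  rw [isUnit_iff_isUnit_det, h, det_mul] at this
  exact (isUnit_iff_isUnit_det _).2 (isUnit_of_mul_isUnit_left this)

lemma gaussianReal_Ioi_lt {a b : ℝ} (hab : a < b) :
    gaussianReal 0 1 (Set.Ioi b) < gaussianReal 0 1 (Set.Ioi a) := by
  have hpos : gaussianReal 0 1 (Set.Ioc a b) ≠ 0 := fun h0 => by
    have := gaussianReal_absolutelyContinuous' 0 one_ne_zero h0
    rw [Real.volume_Ioc, ENNReal.ofReal_eq_zero] at this
    linarith
  rw [← Set.Ioc_union_Ioi_eq_Ioi hab.le, measure_union (Set.Ioc_disjoint_Ioi le_rfl)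
    measurableSet_Ioi, add_comm]
  exact ENNReal.lt_add_right (measure_ne_top _ _) hpos

lemma gaussianReal_Iic_zero_le : (gaussianReal 0 1 (Set.Iic 0)).toReal ≤ 1 / 2 := by
  have := nullSingletonClass_gaussianReal (μ := 0) (v := 1) one_ne_zero
  have h1 : gaussianReal 0 1 (Set.Iic 0) = gaussianReal 0 1 (Set.Ioi 0) := by
    rw [measure_congr (Ioi_ae_eq_Ici (a := (0 : ℝ)))]
    have h := gaussianReal_map_neg (μ := 0) (v := 1)
    rw [neg_zero] at h
    conv_lhs => rw [← h, Measure.map_apply (by fun_prop) measurableSet_Iic]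
    congr 1
    ext x
    simp
  have h2 := prob_compl_eq_one_sub (μ := gaussianReal 0 1) (measurableSet_Iic (a := (0 : ℝ)))
  rw [Set.compl_Iic, ← h1] at h2
  have h3 := congrArg ENNReal.toReal h2
  rw [ENNReal.toReal_sub_of_le prob_le_one ENNReal.one_ne_top, ENNReal.toReal_one] at h3
  linarith

lemma gaussianReal_Ioi_toReal_le (q : ℝ) (hq : 0 ≤ q) :
    (gaussianReal 0 1 (Set.Ioi q)).toReal ≤ Real.exp (-(q ^ 2 / 2)) := by
  have h := measure_ge_le_exp_mul_mgf (μ := gaussianReal 0 1) (X := id) q hq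
    (integrable_exp_mul_gaussianReal q)
  rw [mgf_id_gaussianReal, ← Real.exp_add] at h
  refine (measureReal_mono (s₂ := {x | q ≤ id x})
    (fun x hx => le_of_lt (Set.mem_Ioi.1 hx))).trans (h.trans (le_of_eq ?_))
  congr 1
  simp
  ring

lemma convexOn_sqrt_mul_dotProduct_mulVec {d : ℕ} {Q : Matrix (Fin d) (Fin d) ℝ} (hQ : Q.PosDef)
    {κ : ℝ} (hκ : 0 ≤ κ) : ConvexOn ℝ Set.univ fun f : Fin d → ℝ => √(κ * (f ⬝ᵥ Q *ᵥ f)) := by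
  obtain ⟨S, -, rfl⟩ := hQ.exists_isUnit_mul_transpose
  let L : (Fin d → ℝ) →ₗ[ℝ] EuclideanSpace ℝ (Fin d) :=
    (WithLp.linearEquiv 2 ℝ (Fin d → ℝ)).symm.toLinearMap ∘ₗ Sᵀ.mulVecLin
  have h : (fun f : Fin d → ℝ => √(κ * (f ⬝ᵥ (S * Sᵀ) *ᵥ f))) = fun f => √κ * ‖L f‖ := by
    funext f
    rw [Real.sqrt_mul hκ, EuclideanSpace.norm_eq, ← mulVec_mulVec, dotProduct_mulVec,
      ← mulVec_transpose]
    simp [L, dotProduct, sq, mulVec_transpose]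
  rw [h]
  exact (convexOn_univ_norm.comp_linearMap L).smul (Real.sqrt_nonneg κ)

/-- If an affine function plus a multiple of the norm given by `S * Sᵀ` is bounded below, then the
linear part has small dual norm. -/
lemma dotProduct_le_of_forall_le {d : ℕ} {S : Matrix (Fin d) (Fin d) ℝ} (hS : IsUnit S)
    {κ t r : ℝ} (hκ : 0 ≤ κ) (δ : Fin d → ℝ)
    (h : ∀ f : Fin d → ℝ, t ≤ (1 / 2) * (f ⬝ᵥ S *ᵥ δ - r) + √(κ * (f ⬝ᵥ (S * Sᵀ) *ᵥ f))) :
    δ ⬝ᵥ δ ≤ 4 * κ := by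
  by_contra! hD
  set D := δ ⬝ᵥ δ
  have hdet := (isUnit_iff_isUnit_det S).1 hS
  have hray : ∀ l : ℝ, 0 ≤ l → t ≤ (1 / 2) * (-l * D - r) + l * (√κ * √D) := by
    intro l hl
    have hw : ((-l) • (δ ᵥ* S⁻¹)) ᵥ* S = (-l) • δ := by
      rw [smul_vecMul, vecMul_vecMul, nonsing_inv_mul _ hdet, vecMul_one]
    have := h ((-l) • (δ ᵥ* S⁻¹))
    rw [← mulVec_mulVec, mulVec_transpose, dotProduct_mulVec, dotProduct_mulVec, hw,
      smul_dotProduct, smul_dotProduct, dotProduct_smul] at this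
    have he : √(κ * (-l • -l • (δ ⬝ᵥ δ))) = l * (√κ * √D) := by
      rw [← Real.sqrt_mul hκ, ← Real.sqrt_sq hl, ← Real.sqrt_mul (sq_nonneg _), Real.sqrt_sq hl]
      congr 1
      simp only [smul_eq_mul, D]
      ring
    rw [he] at this
    simpa using this
  have hD0 : 0 ≤ D := by linarith
  have h1 : 2 * √κ < √D := by
    rw [Real.lt_sqrt (by positivity), mul_pow, Real.sq_sqrt hκ]
    linarith
  have hs := Real.sq_sqrt hD0
  have hgap : 0 < D / 2 - √κ * √D := by nlinarith [Real.sqrt_nonneg κ]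
  have h2 := hray ((|t| + |r| + 1) / (D / 2 - √κ * √D)) (by positivity)
  have h3 : (|t| + |r| + 1) / (D / 2 - √κ * √D) * (D / 2 - √κ * √D) = |t| + |r| + 1 :=
    div_mul_cancel₀ _ hgap.ne'
  have := neg_abs_le t
  have := neg_abs_le r
  have := abs_nonneg r
  nlinarith

lemma continuous_dotProduct_left {n : ℕ} (h : Fin n → ℝ) :
    Continuous fun u : Fin n → ℝ => u ⬝ᵥ h :=
  Continuous.dotProduct continuous_id continuous_const

lemma le_phiSupp {n : ℕ} {U : Set (Fin n → ℝ)} (hU : IsCompact U) {u : Fin n → ℝ} (hu : u ∈ U)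
    (h : Fin n → ℝ) : u ⬝ᵥ h ≤ phiSupp U h :=
  le_csSup (hU.image (continuous_dotProduct_left h)).bddAbove (Set.mem_image_of_mem _ hu)

lemma exists_eq_phiSupp {n : ℕ} {U : Set (Fin n → ℝ)} (hU : IsCompact U) (hne : U.Nonempty)
    (h : Fin n → ℝ) : ∃ u ∈ U, phiSupp U h = u ⬝ᵥ h :=
  hU.exists_sSup_image_eq hne (continuous_dotProduct_left h).continuousOn

/-- Minimax form of the convex program: any level below its value is attained uniformly in `f`
by a single triple of parameters. -/
lemma exists_forall_le_of_lt_sInf {d nu nv : ℕ}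
    {U : Set (Fin nu → ℝ)} (hUne : U.Nonempty) (hUconv : Convex ℝ U) (hUcpt : IsCompact U)
    {V : Set (Fin nv → ℝ)} (hVne : V.Nonempty) (hVconv : Convex ℝ V) (hVcpt : IsCompact V)
    (A : Matrix (Fin d) (Fin nu) ℝ)
    (M : (Fin nv → ℝ) →ᵃ[ℝ] Matrix (Fin d) (Fin d) ℝ) (hMpd : ∀ v ∈ V, (M v).PosDef)
    (g : Fin nu → ℝ) {κ : ℝ} (hκ : 0 ≤ κ) {t : ℝ}
    (ht : t < sInf (Set.range (fun f : Fin d → ℝ =>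
      (1/2) * (phiSupp U (Matrix.vecMul f A - g) + phiSupp U (-(Matrix.vecMul f A) + g))
      + sSup ((fun v => Real.sqrt (κ * (f ⬝ᵥ (M v).mulVec f))) '' V)))) :
    ∃ u ∈ U, ∃ u' ∈ U, ∃ v ∈ V, ∀ f : Fin d → ℝ,
      t ≤ (1 / 2) * ((u - u') ⬝ᵥ (f ᵥ* A - g)) + √(κ * (f ⬝ᵥ M v *ᵥ f)) := by
  have hMcont : Continuous M := by
    rw [M.decomp]
    exact M.linear.continuous_of_finiteDimensional.add continuous_const
  have hqv : ∀ f : Fin d → ℝ, Continuous fun v => √(κ * (f ⬝ᵥ M v *ᵥ f)) := fun f =>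
    (continuous_const.mul (Continuous.dotProduct continuous_const
      (Continuous.matrix_mulVec hMcont continuous_const))).sqrt
  have hpos : ∀ v ∈ V, ∀ f : Fin d → ℝ, 0 ≤ f ⬝ᵥ M v *ᵥ f := fun v hv f => by
    simpa using (hMpd v hv).posSemidef.dotProduct_mulVec_nonneg f
  have hneg : ∀ f : Fin d → ℝ, -(f ᵥ* A) + g = -(f ᵥ* A - g) := fun f => by abel
  have hbdd : BddBelow (Set.range (fun f : Fin d → ℝ =>
      (1/2) * (phiSupp U (Matrix.vecMul f A - g) + phiSupp U (-(Matrix.vecMul f A) + g))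
      + sSup ((fun v => Real.sqrt (κ * (f ⬝ᵥ (M v).mulVec f))) '' V))) := by
    refine ⟨0, ?_⟩
    rintro _ ⟨f, rfl⟩
    obtain ⟨u, hu⟩ := hUne
    have h1 := le_phiSupp hUcpt hu (f ᵥ* A - g)
    have h2 := le_phiSupp hUcpt hu (-(f ᵥ* A) + g)
    rw [hneg, dotProduct_neg] at h2
    have h3 : 0 ≤ sSup ((fun v => Real.sqrt (κ * (f ⬝ᵥ (M v).mulVec f))) '' V) :=
      Real.sSup_nonneg (by rintro _ ⟨v, -, rfl⟩; exact Real.sqrt_nonneg _)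
    simp only [hneg]
    linarith
  obtain ⟨x, ⟨hu, hu', hv⟩, hx⟩ := exists_forall_le_of_forall_exists_le
    (X := U ×ˢ U ×ˢ V) (hUne.prod (hUne.prod hVne)) (hUconv.prod (hUconv.prod hVconv))
    (hUcpt.prod (hUcpt.prod hVcpt))
    (G := fun x f => (1 / 2) * ((x.1 - x.2.1) ⬝ᵥ (f ᵥ* A - g)) + √(κ * (f ⬝ᵥ M x.2.2 *ᵥ f)))
    (fun f => Continuous.continuousOn <| by
      have := (hqv f).comp (continuous_snd.comp
        (continuous_snd (X := Fin nu → ℝ) (Y := (Fin nu → ℝ) × (Fin nv → ℝ))))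
      refine Continuous.add (continuous_const.mul (Continuous.dotProduct (by fun_prop)
        continuous_const)) this)
    (fun f => by
      refine ⟨hUconv.prod (hUconv.prod hVconv), ?_⟩
      rintro ⟨u₁, u₁', v₁⟩ ⟨-, -, hv₁⟩ ⟨u₂, u₂', v₂⟩ ⟨-, -, hv₂⟩ a b ha hb hab
      have hM : M (a • v₁ + b • v₂) = a • M v₁ + b • M v₂ := Convex.combo_affine_apply hab
      have hs := Real.strictConcaveOn_sqrt.concaveOn.2
        (x := κ * (f ⬝ᵥ M v₁ *ᵥ f)) (mul_nonneg hκ (hpos v₁ hv₁ f))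
        (y := κ * (f ⬝ᵥ M v₂ *ᵥ f)) (mul_nonneg hκ (hpos v₂ hv₂ f)) ha hb hab
      simp only [Prod.smul_mk, Prod.mk_add_mk, hM, smul_eq_mul] at hs ⊢
      have e1 : κ * (f ⬝ᵥ (a • M v₁ + b • M v₂) *ᵥ f)
          = a * (κ * (f ⬝ᵥ M v₁ *ᵥ f)) + b * (κ * (f ⬝ᵥ M v₂ *ᵥ f)) := by
        simp only [add_mulVec, smul_mulVec, dotProduct_add, dotProduct_smul, smul_eq_mul]
        ring
      have e2 : (a • u₁ + b • u₂ - (a • u₁' + b • u₂')) ⬝ᵥ (f ᵥ* A - g)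
          = a * ((u₁ - u₁') ⬝ᵥ (f ᵥ* A - g)) + b * ((u₂ - u₂') ⬝ᵥ (f ᵥ* A - g)) := by
        simp only [add_dotProduct, sub_dotProduct, smul_dotProduct, smul_eq_mul]
        ring
      rw [e1, e2]
      linarith)
    (fun x _ => by
      refine Continuous.add (continuous_const.mul (Continuous.dotProduct continuous_const
        ((Continuous.matrix_vecMul continuous_id continuous_const).sub continuous_const))) ?_
      exact (continuous_const.mul (Continuous.dotProduct continuous_id
        (Continuous.matrix_mulVec continuous_const continuous_id))).sqrt)
    (fun x hx => by
      refine ConvexOn.add ⟨convex_univ, ?_⟩ (convexOn_sqrt_mul_dotProduct_mulVec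
        (hMpd _ hx.2.2) hκ)
      intro f₁ _ f₂ _ a b _ _ hab
      have e : (a • f₁ + b • f₂) ᵥ* A - g = a • (f₁ ᵥ* A - g) + b • (f₂ ᵥ* A - g) := by
        have : g = (a + b) • g := by rw [hab, one_smul]
        rw [add_vecMul, smul_vecMul, smul_vecMul]
        conv_lhs => rw [this]
        module
      simp only [e, dotProduct_add, dotProduct_smul, smul_eq_mul]
      linarith)
    ht (fun f => by
      obtain ⟨u, hu, hu1⟩ := exists_eq_phiSupp hUcpt hUne (f ᵥ* A - g)
      obtain ⟨u', hu', hu2⟩ := exists_eq_phiSupp hUcpt hUne (-(f ᵥ* A) + g)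
      obtain ⟨v, hv, hv1⟩ := hVcpt.exists_sSup_image_eq hVne (hqv f).continuousOn
      refine ⟨(u, u', v), ⟨hu, hu', hv⟩, (csInf_le hbdd ⟨f, rfl⟩).trans (le_of_eq ?_)⟩
      rw [hneg, dotProduct_neg] at hu2
      simp only [hneg, hu1, hu2, hv1, sub_dotProduct]
      ring)
  exact ⟨x.1, hu, x.2.1, hu', x.2.2, hv, hx⟩

lemma quantile_pos {ε q : ℝ} (hε : ε < 1 / 2)
    (hq : (gaussianReal 0 1 (Set.Iic q)).toReal = 1 - ε) : 0 < q := by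
  by_contra! h
  have h1 : (gaussianReal 0 1 (Set.Iic q)).toReal ≤ (gaussianReal 0 1 (Set.Iic 0)).toReal :=
    measureReal_mono (Set.Iic_subset_Iic.2 h)
  linarith [gaussianReal_Iic_zero_le]

lemma gaussianReal_Ioi_quantile {ε q : ℝ}
    (hq : (gaussianReal 0 1 (Set.Iic q)).toReal = 1 - ε) :
    (gaussianReal 0 1 (Set.Ioi q)).toReal = ε := by
  have h2 := probReal_compl_eq_one_sub (μ := gaussianReal 0 1) (measurableSet_Iic (a := q))
  rw [Set.compl_Iic] at h2
  simp only [measureReal_def] at h2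
  linarith

lemma quantile_le_sqrt {ε q : ℝ} (hε0 : 0 < ε) (hq0 : 0 < q)
    (hq : (gaussianReal 0 1 (Set.Iic q)).toReal = 1 - ε) : q ≤ √(2 * Real.log (2 / ε)) := by
  have h := gaussianReal_Ioi_toReal_le q hq0.le
  rw [gaussianReal_Ioi_quantile hq] at h
  have h1 := (Real.log_le_iff_le_exp hε0).2 h
  rw [Real.le_sqrt' hq0, Real.log_div two_ne_zero hε0.ne']
  have := Real.log_nonneg (one_le_two (α := ℝ))
  linarith

/-- near-optimality, Proposition 4.3: the optimal value `Opt` of the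
convex program (51) is within factor `√(2 ln(2/ε))/q_N(1−ε)` of the minimax ε-risk of
recovering `gᵀu` from `K` i.i.d. sub-Gaussian observations with parameters
`(Au+a, M(v))`, `(u,v) ∈ U×V`. -/
theorem statement16 {d nu nv : ℕ}
    (U : Set (Fin nu → ℝ)) (hUne : U.Nonempty) (hUconv : Convex ℝ U)
    (hUcpt : IsCompact U)
    (V : Set (Fin nv → ℝ)) (hVne : V.Nonempty) (hVconv : Convex ℝ V)
    (hVcpt : IsCompact V)
    (A : Matrix (Fin d) (Fin nu) ℝ) (a : Fin d → ℝ)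
    (M : (Fin nv → ℝ) →ᵃ[ℝ] Matrix (Fin d) (Fin d) ℝ)
    (hMsym : ∀ v, (M v).IsSymm) (hMpd : ∀ v ∈ V, (M v).PosDef)
    (g : Fin nu → ℝ) (K : ℕ) (hK : 1 ≤ K)
    (ε : ℝ) (hε0 : 0 < ε) (hε1 : ε < 1/2)
    (Opt : ℝ)
    (hOpt : Opt = sInf (Set.range (fun f : Fin d → ℝ =>
      (1/2) * (phiSupp U (Matrix.vecMul f A - g) + phiSupp U (-(Matrix.vecMul f A) + g))
      + sSup ((fun v => Real.sqrt
          (2 * (K : ℝ)⁻¹ * Real.log (2/ε) * (f ⬝ᵥ (M v).mulVec f))) '' V))))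
    (RiskOpt : ℝ)
    (hRiskOpt : RiskOpt = sInf {ρ : ℝ |
      ∃ ghat : (Fin K → Fin d → ℝ) → ℝ, Measurable ghat ∧
        ∀ u ∈ U, ∀ v ∈ V, ∀ P : Measure (Fin d → ℝ), IsProbabilityMeasure P →
          SubGaussianWith (A.mulVec u + a) (M v) P →
          (Measure.pi fun _ : Fin K => P) {ω | ρ < |ghat ω - g ⬝ᵥ u|}
            ≤ ENNReal.ofReal ε})
    (q : ℝ) (hq : (ProbabilityTheory.gaussianReal 0 1 (Set.Iic q)).toReal = 1 - ε) :
    Opt ≤ (Real.sqrt (2 * Real.log (2/ε)) / q) * RiskOpt := by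
  have hq0 : 0 < q := quantile_pos hε1 hq
  have hqc := quantile_le_sqrt hε0 hq0 hq
  set c : ℝ := √(2 * Real.log (2 / ε)) with hc
  have hc0 : 0 < c := hq0.trans_le hqc
  have hlog : 0 < 2 * Real.log (2 / ε) := Real.sqrt_pos.1 hc0
  have hKpos : (0 : ℝ) < K := by exact_mod_cast hK
  set κ : ℝ := 2 * (K : ℝ)⁻¹ * Real.log (2 / ε) with hκ
  have hKκ : K * κ = c ^ 2 := by
    rw [hc, Real.sq_sqrt hlog.le, hκ]
    field_simp
  have hκ0 : 0 ≤ κ := by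
    have : 0 ≤ K * κ := hKκ ▸ sq_nonneg c
    exact nonneg_of_mul_nonneg_right this hKpos
  suffices h : Opt * (q / c) ≤ RiskOpt by
    rw [div_mul_eq_mul_div, le_div_iff₀ hq0]
    calc Opt * q = c * (Opt * (q / c)) := by field_simp
      _ ≤ c * RiskOpt := mul_le_mul_of_nonneg_left h hc0.le
  rw [hRiskOpt]
  refine le_csInf ?_ ?_
  · obtain ⟨C, hC⟩ := (hUcpt.image (continuous_dotProduct_left g).abs).bddAbove
    refine ⟨C, fun _ => 0, measurable_const, fun u hu v _ P _ _ => ?_⟩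
    have hle : |g ⬝ᵥ u| ≤ C := by
      rw [dotProduct_comm]; exact hC (Set.mem_image_of_mem _ hu)
    simp [not_lt.2 hle]
  rintro ρ ⟨ghat, hghat, hrisk⟩
  by_contra! hρ
  obtain ⟨t, ht1, ht2⟩ : ∃ t, ρ < t * (q / c) ∧ t < Opt := by
    obtain ⟨t, h1, h2⟩ := exists_between ((div_lt_iff₀ (by positivity)).2 hρ)
    exact ⟨t, (div_lt_iff₀ (by positivity)).1 h1, h2⟩
  rw [hOpt] at ht2
  obtain ⟨u, hu, u', hu', v, hv, hall⟩ := exists_forall_le_of_lt_sInf hUne hUconv hUcpt hVne hVconv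
    hVcpt A M hMpd g hκ0 ht2
  have hgap : t ≤ (1 / 2) * (g ⬝ᵥ (u' - u)) := by
    have := hall 0
    simp only [zero_vecMul, zero_sub, dotProduct_neg, zero_dotProduct, mul_zero, Real.sqrt_zero,
      add_zero] at this
    rw [dotProduct_comm, ← dotProduct_neg, neg_sub] at this
    exact this
  obtain ⟨S, hS, hMS⟩ := (hMpd v hv).exists_isUnit_mul_transpose
  have hdet := (isUnit_iff_isUnit_det S).1 hS
  set δ : Fin d → ℝ := S⁻¹ *ᵥ (A *ᵥ (u - u')) with hδ
  have hSδ : S *ᵥ δ = A *ᵥ (u - u') := by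
    rw [hδ, mulVec_mulVec, mul_nonsing_inv _ hdet, one_mulVec]
  have hD : δ ⬝ᵥ δ ≤ 4 * κ := by
    refine dotProduct_le_of_forall_le (t := t) (r := (u - u') ⬝ᵥ g) hS hκ0 δ fun f => ?_
    have := hall f
    rwa [hMS, dotProduct_sub, dotProduct_comm (u - u') (f ᵥ* A), ← dotProduct_mulVec,
      ← hSδ] at this
  obtain ⟨γ, hγ0, hγ1, hγ2⟩ : ∃ γ : ℝ, 0 < γ ∧ γ < q / c ∧ ρ < t * γ := by
    have h1 : ∀ᶠ γ in nhds (q / c), ρ < t * γ :=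
      (continuous_const.mul continuous_id).continuousAt.eventually (lt_mem_nhds ht1)
    obtain ⟨γ, hγ, hγ'⟩ := ((h1.filter_mono nhdsWithin_le_nhds).and
      (Ioo_mem_nhdsLT (show 0 < q / c by positivity))).exists
    exact ⟨γ, hγ'.1, hγ'.2, hγ⟩
  have hγ3 : γ ≤ 1 := hγ1.le.trans ((div_le_one hc0).2 hqc)
  set u₀ : Fin nu → ℝ := ((1 - γ) / 2) • u + ((1 + γ) / 2) • u' with hu₀
  set u₁ : Fin nu → ℝ := ((1 + γ) / 2) • u + ((1 - γ) / 2) • u' with hu₁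
  have hu₀U : u₀ ∈ U := hUconv hu hu' (by linarith) (by linarith) (by ring)
  have hu₁U : u₁ ∈ U := hUconv hu hu' (by linarith) (by linarith) (by ring)
  have hu₁₀ : u₁ = u₀ + γ • (u - u') := by rw [hu₀, hu₁]; module
  have hθ : A *ᵥ u₁ + a = A *ᵥ u₀ + a + S *ᵥ (γ • δ) := by
    rw [hu₁₀, mulVec_add, mulVec_smul, mulVec_smul, hSδ]
    abel
  set B : Set (Fin K → Fin d → ℝ) := {ω | ρ < |ghat ω - g ⬝ᵥ u₀|}
  have hB : MeasurableSet B := measurableSet_lt measurable_const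
    (by fun_prop)
  have hP₀ := hrisk u₀ hu₀U v hv (gaussianLaw (A *ᵥ u₀ + a) S) inferInstance
    (hMS ▸ subGaussianWith_gaussianLaw _ S)
  have hP₁ := hrisk u₁ hu₁U v hv (gaussianLaw (A *ᵥ u₁ + a) S) inferInstance
    (hMS ▸ subGaussianWith_gaussianLaw _ S)
  have hBc : Bᶜ ⊆ {ω | ρ < |ghat ω - g ⬝ᵥ u₁|} := by
    intro ω hω
    have h0 : |ghat ω - g ⬝ᵥ u₀| ≤ ρ := not_lt.1 hω
    have h1 : g ⬝ᵥ u₁ = g ⬝ᵥ u₀ - γ * (g ⬝ᵥ (u' - u)) := by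
      rw [hu₁₀, dotProduct_add, dotProduct_smul, ← neg_sub u' u, dotProduct_neg, smul_eq_mul]
      ring
    have h2 : t * γ ≤ (1 / 2) * (g ⬝ᵥ (u' - u)) * γ := mul_le_mul_of_nonneg_right hgap hγ0.le
    have h3 := (abs_le.1 h0).1
    have h4 : ρ < ghat ω - g ⬝ᵥ u₁ := by
      rw [h1]
      linarith
    exact h4.trans_le (le_abs_self _)
  have hmain := two_mul_gaussianReal_Ioi_le (K := K) (A *ᵥ u₀ + a) (γ • δ) S hB
  rw [← hθ] at hmain
  have hlt : √(K * ((γ • δ) ⬝ᵥ (γ • δ))) / 2 < q := by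
    rw [div_lt_iff₀ two_pos, Real.sqrt_lt' (by positivity), smul_dotProduct, dotProduct_smul,
      smul_eq_mul, smul_eq_mul]
    have h1 : K * (γ * (γ * (δ ⬝ᵥ δ))) ≤ 4 * (γ * c) ^ 2 := by
      calc K * (γ * (γ * (δ ⬝ᵥ δ))) ≤ K * (γ * (γ * (4 * κ))) := by gcongr
        _ = 4 * γ ^ 2 * (K * κ) := by ring
        _ = 4 * (γ * c) ^ 2 := by rw [hKκ]; ring
    have h2 : γ * c < q := (lt_div_iff₀ hc0).1 hγ1
    have h3 : (γ * c) ^ 2 < q ^ 2 := by gcongr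
    linarith
  have htail : gaussianReal 0 1 (Set.Ioi q) = ENNReal.ofReal ε := by
    rw [← gaussianReal_Ioi_quantile hq, ENNReal.ofReal_toReal (measure_ne_top _ _)]
  have hfin : 2 * gaussianReal 0 1 (Set.Ioi (√(K * ((γ • δ) ⬝ᵥ (γ • δ))) / 2))
      ≤ 2 * gaussianReal 0 1 (Set.Ioi q) := by
    rw [htail, two_mul (ENNReal.ofReal ε)]
    exact hmain.trans (add_le_add hP₀ ((measure_mono hBc).trans hP₁))
  exact absurd ((ENNReal.mul_le_mul_iff_right two_ne_zero ENNReal.ofNat_ne_top).1 hfin)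
    (gaussianReal_Ioi_lt hlt).not_ge

end
end

section
/- Let A be a d×m column-stochastic matrix (each column in Δ_d), U a nonempty closed subset of Δ_m, Q∈S^m, q∈ℝ^m, and set Q̄ = Q + q𝟙ᵀ + 𝟙qᵀ, where 𝟙∈ℝ^m is the all-ones vector, so that F(u) := uᵀQu + 2qᵀu = uᵀQ̄u for u∈Δ_m. Let 𝒳 be a convex compact subset of {x∈S^m : x_{ij}≥0 for all i,j, Σ_{i,j}x_{ij}=1, x⪰0} containing uuᵀ for every u∈U. Let K≥2 be an integer, M=⌊K/2⌋, ε∈(0,1), and define, for h∈S^d, Ψ̂₊(h) = max_{x∈𝒳} inf_{β>0}[ β·Φ(h/β; AxAᵀ) − Tr(Q̄x) + (β/M)·ln(2/ε) ] and Ψ̂₋(h) = max_{x∈𝒳} inf_{β>0}[ β·Φ(−h/β; AxAᵀ) + Tr(Q̄x) + (β/M)·ln(2/ε) ], where Φ(H;Z) = ln(Σ_{i,j=1}^d Z_{ij}e^{H_{ij}}). Then Ψ̂₊ and Ψ̂₋ are real-valued convex functions on S^d, and for every h̄∈S^d, setting κ(h̄) = (1/2)(Ψ̂₋(h̄) − Ψ̂₊(h̄))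 and ρ̄ = (1/2)(Ψ̂₊(h̄) + Ψ̂₋(h̄)), the estimate ĝ(ζ^K) = Tr(h̄·ω[ζ^K]) + κ(h̄) satisfies, for every u∈U, Prob_{ζ^K∼P_{Au}^K}{ |F(u) − ĝ(ζ^K)| > ρ̄ } ≤ ε, where ζ^K=(ζ_1,…,ζ_K) are i.i.d. with distribution P_{Au}. -/
open Matrix MeasureTheory Real

noncomputable section

/-- The discrete distribution `P_μ` on ℝ^d assigning mass `μ i` to the basis vector `e_i`. -/
def discDist {d : ℕ} (μ : Fin d → ℝ) : Measure (Fin d → ℝ) :=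
  ∑ i, ENNReal.ofReal (μ i) • Measure.dirac (Pi.single i 1)

/-- `ω_{ij} = (1/2)(ζ_iζ_jᵀ + ζ_jζ_iᵀ)` for two vectors. -/
def omegaPair {d : ℕ} (a b : Fin d → ℝ) : Matrix (Fin d) (Fin d) ℝ :=
  (1/2 : ℝ) • (vecMulVec a b + vecMulVec b a)

/-- The quadratic lifting `ω[ζ^K] = (2/(K(K−1)))·Σ_{i<j} ω_{ij}[ζ^K]`. -/
def omegaLift {d K : ℕ} (ζ : Fin K → Fin d → ℝ) : Matrix (Fin d) (Fin d) ℝ :=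
  (2 / ((K : ℝ) * ((K : ℝ) - 1))) •
    ∑ p ∈ Finset.univ.filter (fun p : Fin K × Fin K => p.1 < p.2),
      omegaPair (ζ p.1) (ζ p.2)

/-- `Φ(H;Z) = ln(Σ_{i,j} Z_{ij} e^{H_{ij}})`. -/
def PhiD {d : ℕ} (H Z : Matrix (Fin d) (Fin d) ℝ) : ℝ :=
  Real.log (∑ i, ∑ j, Z i j * Real.exp (H i j))

/-- `Ψ̂₊(h)` of Proposition 5.4. -/
def PsiDQPlus {d m : ℕ} (𝒳 : Set (Matrix (Fin m) (Fin m) ℝ))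
    (A : Matrix (Fin d) (Fin m) ℝ) (Qbar : Matrix (Fin m) (Fin m) ℝ)
    (M : ℕ) (ε : ℝ) (h : Matrix (Fin d) (Fin d) ℝ) : ℝ :=
  sSup ((fun x => sInf {t : ℝ | ∃ β : ℝ, 0 < β ∧
      t = β * PhiD (β⁻¹ • h) (A * x * Aᵀ) - (Qbar * x).trace
          + (β / (M : ℝ)) * Real.log (2/ε)}) '' 𝒳)

/-- `Ψ̂₋(h)` of Proposition 5.4. -/
def PsiDQMinus {d m : ℕ} (𝒳 : Set (Matrix (Fin m) (Fin m) ℝ))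
    (A : Matrix (Fin d) (Fin m) ℝ) (Qbar : Matrix (Fin m) (Fin m) ℝ)
    (M : ℕ) (ε : ℝ) (h : Matrix (Fin d) (Fin d) ℝ) : ℝ :=
  sSup ((fun x => sInf {t : ℝ | ∃ β : ℝ, 0 < β ∧
      t = β * PhiD (β⁻¹ • (-h)) (A * x * Aᵀ) + (Qbar * x).trace
          + (β / (M : ℝ)) * Real.log (2/ε)}) '' 𝒳)

section PhiD

variable {d : ℕ} {Z h : Matrix (Fin d) (Fin d) ℝ}

/-- Nonnegative matrices with entries summing to one. -/
def IsProbMatrix (Z : Matrix (Fin d) (Fin d) ℝ) : Prop :=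
  (∀ i j, 0 ≤ Z i j) ∧ ∑ i, ∑ j, Z i j = 1

/-- The entrywise `ℓ¹` norm. -/
def entrySum (h : Matrix (Fin d) (Fin d) ℝ) : ℝ := ∑ i, ∑ j, |h i j|

lemma abs_le_entrySum (h : Matrix (Fin d) (Fin d) ℝ) (i j : Fin d) : |h i j| ≤ entrySum h :=
  (Finset.single_le_sum (f := fun j => |h i j|) (fun _ _ => abs_nonneg _)
    (Finset.mem_univ j)).trans
  (Finset.single_le_sum (f := fun i => ∑ j, |h i j|)
    (fun _ _ => Finset.sum_nonneg fun _ _ => abs_nonneg _) (Finset.mem_univ i))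

lemma IsProbMatrix.sum_mul_le (hZ : IsProbMatrix Z) {f : Fin d → Fin d → ℝ} {b : ℝ}
    (hf : ∀ i j, f i j ≤ b) : ∑ i, ∑ j, Z i j * f i j ≤ b := by
  calc ∑ i, ∑ j, Z i j * f i j ≤ ∑ i, ∑ j, Z i j * b := by
        gcongr with i _ j _
        · exact hZ.1 i j
        · exact hf i j
    _ = b := by simp_rw [← Finset.sum_mul]; rw [hZ.2, one_mul]

lemma IsProbMatrix.le_sum_mul (hZ : IsProbMatrix Z) {f : Fin d → Fin d → ℝ} {b : ℝ}
    (hf : ∀ i j, b ≤ f i j) : b ≤ ∑ i, ∑ j, Z i j * f i j := by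
  calc b = ∑ i, ∑ j, Z i j * b := by simp_rw [← Finset.sum_mul]; rw [hZ.2, one_mul]
    _ ≤ ∑ i, ∑ j, Z i j * f i j := by
        gcongr with i _ j _
        · exact hZ.1 i j
        · exact hf i j

lemma IsProbMatrix.sum_exp_pos (hZ : IsProbMatrix Z) (h : Matrix (Fin d) (Fin d) ℝ) :
    0 < ∑ i, ∑ j, Z i j * exp (h i j) :=
  (exp_pos (-entrySum h)).trans_le <| hZ.le_sum_mul fun i j =>
    exp_le_exp.2 (neg_le_of_abs_le (abs_le_entrySum h i j))

/-- The perspective `β Φ(h/β; Z)` is at most `t` iff `Σ Z_{ij} e^{(h_{ij} - t)/β} ≤ 1`. -/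
lemma IsProbMatrix.mul_PhiD_le_iff (hZ : IsProbMatrix Z) {β t : ℝ} (hβ : 0 < β) :
    β * PhiD (β⁻¹ • h) Z ≤ t ↔ ∑ i, ∑ j, Z i j * exp ((h i j - t) / β) ≤ 1 := by
  have hsum : ∑ i, ∑ j, Z i j * exp ((h i j - t) / β)
      = (∑ i, ∑ j, Z i j * exp ((β⁻¹ • h) i j)) * exp (-(t / β)) := by
    simp_rw [Finset.sum_mul, mul_assoc, ← exp_add]
    refine Finset.sum_congr rfl fun i _ => Finset.sum_congr rfl fun j _ => ?_
    simp only [Matrix.smul_apply, smul_eq_mul]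
    congr 2
    ring
  rw [hsum, PhiD, mul_comm, ← le_div_iff₀ hβ, Real.log_le_iff_le_exp (hZ.sum_exp_pos _),
    exp_neg, ← div_eq_mul_inv, div_le_one (exp_pos _)]

lemma IsProbMatrix.mul_PhiD_le (hZ : IsProbMatrix Z) {β : ℝ} (hβ : 0 < β) :
    β * PhiD (β⁻¹ • h) Z ≤ entrySum h := by
  rw [hZ.mul_PhiD_le_iff hβ]
  refine hZ.sum_mul_le fun i j => exp_le_one_iff.2 (div_nonpos_of_nonpos_of_nonneg ?_ hβ.le)
  linarith [le_of_abs_le (abs_le_entrySum h i j)]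

lemma IsProbMatrix.neg_entrySum_le_mul_PhiD (hZ : IsProbMatrix Z) {β : ℝ} (hβ : 0 < β) :
    -entrySum h ≤ β * PhiD (β⁻¹ • h) Z := by
  have key : -entrySum h / β ≤ PhiD (β⁻¹ • h) Z := by
    rw [PhiD, Real.le_log_iff_exp_le (hZ.sum_exp_pos _)]
    refine hZ.le_sum_mul fun i j => exp_le_exp.2 ?_
    rw [Matrix.smul_apply, smul_eq_mul, inv_mul_eq_div]
    gcongr
    exact neg_le_of_abs_le (abs_le_entrySum h i j)
  rwa [div_le_iff₀' hβ] at key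

/-- Joint convexity of the perspective `(β, h) ↦ β Φ(h/β; Z)`. -/
lemma IsProbMatrix.mul_PhiD_convex (hZ : IsProbMatrix Z) {h₁ h₂ : Matrix (Fin d) (Fin d) ℝ}
    {β₁ β₂ a b : ℝ} (hβ₁ : 0 < β₁) (hβ₂ : 0 < β₂) (ha : 0 ≤ a) (hb : 0 ≤ b) (hab : a + b = 1) :
    (a * β₁ + b * β₂) * PhiD ((a * β₁ + b * β₂)⁻¹ • (a • h₁ + b • h₂)) Z
      ≤ a * (β₁ * PhiD (β₁⁻¹ • h₁) Z) + b * (β₂ * PhiD (β₂⁻¹ • h₂) Z) := by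
  have hβ : 0 < a * β₁ + b * β₂ := convex_Ioi (0 : ℝ) hβ₁ hβ₂ ha hb hab
  set β := a * β₁ + b * β₂ with hβdef
  set t₁ := β₁ * PhiD (β₁⁻¹ • h₁) Z with ht₁
  set t₂ := β₂ * PhiD (β₂⁻¹ • h₂) Z with ht₂
  have h₁le := (hZ.mul_PhiD_le_iff (h := h₁) hβ₁).1 ht₁.ge
  have h₂le := (hZ.mul_PhiD_le_iff (h := h₂) hβ₂).1 ht₂.ge
  rw [hZ.mul_PhiD_le_iff hβ]
  have hw : a * β₁ / β + b * β₂ / β = 1 := by rw [← add_div, ← hβdef, div_self hβ.ne']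
  have hw₁ : 0 ≤ a * β₁ / β := by positivity
  have hw₂ : 0 ≤ b * β₂ / β := by positivity
  calc ∑ i, ∑ j, Z i j * exp (((a • h₁ + b • h₂) i j - (a * t₁ + b * t₂)) / β)
      ≤ ∑ i, ∑ j, Z i j * (a * β₁ / β * exp ((h₁ i j - t₁) / β₁)
          + b * β₂ / β * exp ((h₂ i j - t₂) / β₂)) := by
        gcongr with i _ j _
        · exact hZ.1 i j
        · have := convexOn_exp.2 (Set.mem_univ ((h₁ i j - t₁) / β₁))
            (Set.mem_univ ((h₂ i j - t₂) / β₂)) hw₁ hw₂ hw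
          simp only [smul_eq_mul] at this
          refine le_trans (le_of_eq ?_) this
          congr 1
          simp only [Matrix.add_apply, Matrix.smul_apply, smul_eq_mul]
          field_simp
          ring
    _ = a * β₁ / β * ∑ i, ∑ j, Z i j * exp ((h₁ i j - t₁) / β₁)
        + b * β₂ / β * ∑ i, ∑ j, Z i j * exp ((h₂ i j - t₂) / β₂) := by
        simp_rw [Finset.mul_sum, ← Finset.sum_add_distrib]
        refine Finset.sum_congr rfl fun i _ => Finset.sum_congr rfl fun j _ => ?_
        ring
    _ ≤ a * β₁ / β * 1 + b * β₂ / β * 1 := by gcongr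
    _ = 1 := by rw [mul_one, mul_one, hw]

end PhiD

section PsiAux

variable {d m : ℕ}

/-- The values `β Φ(h/β; Z) + r + (β/M) L` over `β > 0`. -/
def tiltSet (M : ℕ) (L r : ℝ) (Z h : Matrix (Fin d) (Fin d) ℝ) : Set ℝ :=
  {t | ∃ β : ℝ, 0 < β ∧ t = β * PhiD (β⁻¹ • h) Z + r + (β / (M : ℝ)) * L}

lemma tiltSet_nonempty (M : ℕ) (L r : ℝ) (Z h : Matrix (Fin d) (Fin d) ℝ) :
    (tiltSet M L r Z h).Nonempty :=
  ⟨_, 1, one_pos, rfl⟩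

lemma IsProbMatrix.lower_mem_lowerBounds {Z h : Matrix (Fin d) (Fin d) ℝ} (hZ : IsProbMatrix Z)
    (M : ℕ) {L : ℝ} (hL : 0 ≤ L) (r : ℝ) : -entrySum h + r ∈ lowerBounds (tiltSet M L r Z h) := by
  rintro _ ⟨β, hβ, rfl⟩
  have := hZ.neg_entrySum_le_mul_PhiD (h := h) hβ
  have : 0 ≤ β / (M : ℝ) * L := by positivity
  linarith

lemma IsProbMatrix.bddBelow_tiltSet {Z h : Matrix (Fin d) (Fin d) ℝ} (hZ : IsProbMatrix Z)
    (M : ℕ) {L : ℝ} (hL : 0 ≤ L) (r : ℝ) : BddBelow (tiltSet M L r Z h) :=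
  ⟨_, hZ.lower_mem_lowerBounds M hL r⟩

lemma IsProbMatrix.sInf_tiltSet_le {Z h : Matrix (Fin d) (Fin d) ℝ} (hZ : IsProbMatrix Z)
    (M : ℕ) {L : ℝ} (hL : 0 ≤ L) (r : ℝ) :
    sInf (tiltSet M L r Z h) ≤ entrySum h + r + 1 / (M : ℝ) * L := by
  refine (csInf_le (hZ.bddBelow_tiltSet M hL r) ⟨1, one_pos, rfl⟩).trans ?_
  gcongr
  exact hZ.mul_PhiD_le one_pos

lemma IsProbMatrix.sInf_tiltSet_convex {Z h₁ h₂ : Matrix (Fin d) (Fin d) ℝ}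
    (hZ : IsProbMatrix Z) (M : ℕ) {L : ℝ} (hL : 0 ≤ L) (r : ℝ) {a b : ℝ}
    (ha : 0 ≤ a) (hb : 0 ≤ b) (hab : a + b = 1) :
    sInf (tiltSet M L r Z (a • h₁ + b • h₂))
      ≤ a * sInf (tiltSet M L r Z h₁) + b * sInf (tiltSet M L r Z h₂) := by
  refine le_of_forall_pos_le_add fun δ hδ => ?_
  obtain ⟨_, ⟨β₁, hβ₁, rfl⟩, h₁lt⟩ := exists_lt_of_csInf_lt (tiltSet_nonempty M L r Z h₁)
    (lt_add_of_pos_right _ hδ)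
  obtain ⟨_, ⟨β₂, hβ₂, rfl⟩, h₂lt⟩ := exists_lt_of_csInf_lt (tiltSet_nonempty M L r Z h₂)
    (lt_add_of_pos_right _ hδ)
  have hβ : 0 < a * β₁ + b * β₂ := convex_Ioi (0 : ℝ) hβ₁ hβ₂ ha hb hab
  have hconv := hZ.mul_PhiD_convex (h₁ := h₁) (h₂ := h₂) hβ₁ hβ₂ ha hb hab
  have hinf := csInf_le (hZ.bddBelow_tiltSet (h := a • h₁ + b • h₂) M hL r) ⟨_, hβ, rfl⟩
  have e₁ := mul_le_mul_of_nonneg_left h₁lt.le ha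
  have e₂ := mul_le_mul_of_nonneg_left h₂lt.le hb
  obtain rfl : b = 1 - a := by linarith
  refine hinf.trans ?_
  have hsplit : (a * β₁ + (1 - a) * β₂) / (M : ℝ) * L
      = a * (β₁ / M * L) + (1 - a) * (β₂ / M * L) := by ring
  rw [hsplit]
  linarith

/-- Common form of `Ψ̂₊` and `Ψ̂₋`. -/
def PsiAux (𝒳 : Set (Matrix (Fin m) (Fin m) ℝ)) (A : Matrix (Fin d) (Fin m) ℝ)
    (ℓ : Matrix (Fin m) (Fin m) ℝ → ℝ) (M : ℕ) (L : ℝ) (h : Matrix (Fin d) (Fin d) ℝ) : ℝ :=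
  sSup ((fun x => sInf (tiltSet M L (ℓ x) (A * x * Aᵀ) h)) '' 𝒳)

lemma PsiDQPlus_eq_PsiAux (𝒳 : Set (Matrix (Fin m) (Fin m) ℝ)) (A : Matrix (Fin d) (Fin m) ℝ)
    (Qbar : Matrix (Fin m) (Fin m) ℝ) (M : ℕ) (ε : ℝ) (h : Matrix (Fin d) (Fin d) ℝ) :
    PsiDQPlus 𝒳 A Qbar M ε h
      = PsiAux 𝒳 A (fun x => -(Qbar * x).trace) M (Real.log (2 / ε)) h := by
  simp only [PsiDQPlus, PsiAux, tiltSet, sub_eq_add_neg]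

lemma PsiDQMinus_eq_PsiAux (𝒳 : Set (Matrix (Fin m) (Fin m) ℝ)) (A : Matrix (Fin d) (Fin m) ℝ)
    (Qbar : Matrix (Fin m) (Fin m) ℝ) (M : ℕ) (ε : ℝ) (h : Matrix (Fin d) (Fin d) ℝ) :
    PsiDQMinus 𝒳 A Qbar M ε h
      = PsiAux 𝒳 A (fun x => (Qbar * x).trace) M (Real.log (2 / ε)) (-h) := rfl

variable {𝒳 : Set (Matrix (Fin m) (Fin m) ℝ)} {A : Matrix (Fin d) (Fin m) ℝ}
  {ℓ : Matrix (Fin m) (Fin m) ℝ → ℝ} {L : ℝ}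

lemma isProbMatrix_conj (hA0 : ∀ i j, 0 ≤ A i j) (hA1 : ∀ j, ∑ i, A i j = 1)
    {x : Matrix (Fin m) (Fin m) ℝ} (hx0 : ∀ i j, 0 ≤ x i j) (hx1 : ∑ i, ∑ j, x i j = 1) :
    IsProbMatrix (A * x * Aᵀ) := by
  refine ⟨fun i j => ?_, ?_⟩
  · simp only [Matrix.mul_apply, Matrix.transpose_apply]
    exact Finset.sum_nonneg fun k _ => mul_nonneg
      (Finset.sum_nonneg fun l _ => mul_nonneg (hA0 i l) (hx0 l k)) (hA0 j k)
  · have hcol : ∀ k, ∑ i, (A * x) i k = ∑ l, x l k := fun k => by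
      simp only [Matrix.mul_apply]
      rw [Finset.sum_comm]
      simp_rw [← Finset.sum_mul, hA1, one_mul]
    have hrow : ∀ i, ∑ j, (A * x * Aᵀ) i j = ∑ k, (A * x) i k := fun i => by
      simp only [Matrix.mul_apply (M := A * x), Matrix.transpose_apply]
      rw [Finset.sum_comm]
      simp_rw [← Finset.mul_sum, hA1, mul_one]
    calc ∑ i, ∑ j, (A * x * Aᵀ) i j = ∑ i, ∑ k, (A * x) i k :=
          Finset.sum_congr rfl fun i _ => hrow i
      _ = ∑ k, ∑ i, (A * x) i k := Finset.sum_comm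
      _ = ∑ k, ∑ l, x l k := Finset.sum_congr rfl fun k _ => hcol k
      _ = 1 := Finset.sum_comm.trans hx1

lemma bddAbove_PsiAux (hprob : ∀ x ∈ 𝒳, IsProbMatrix (A * x * Aᵀ)) (h𝒳 : IsCompact 𝒳)
    (hℓ : Continuous ℓ) (M : ℕ) (hL : 0 ≤ L) (h : Matrix (Fin d) (Fin d) ℝ) :
    BddAbove ((fun x => sInf (tiltSet M L (ℓ x) (A * x * Aᵀ) h)) '' 𝒳) := by
  obtain ⟨C, hC⟩ := h𝒳.bddAbove_image hℓ.continuousOn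
  refine ⟨entrySum h + C + 1 / (M : ℝ) * L, ?_⟩
  rintro _ ⟨x, hx, rfl⟩
  refine ((hprob x hx).sInf_tiltSet_le M hL (ℓ x)).trans ?_
  gcongr
  exact hC (Set.mem_image_of_mem ℓ hx)

lemma convexOn_PsiAux (hprob : ∀ x ∈ 𝒳, IsProbMatrix (A * x * Aᵀ)) (h𝒳 : IsCompact 𝒳)
    (hne : 𝒳.Nonempty) (hℓ : Continuous ℓ) (M : ℕ) (hL : 0 ≤ L) :
    ConvexOn ℝ Set.univ (PsiAux 𝒳 A ℓ M L) := by
  refine ⟨convex_univ, fun h₁ _ h₂ _ a b ha hb hab => csSup_le (hne.image _) ?_⟩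
  rintro _ ⟨x, hx, rfl⟩
  refine ((hprob x hx).sInf_tiltSet_convex M hL (ℓ x) ha hb hab).trans ?_
  simp only [smul_eq_mul]
  gcongr
  · exact le_csSup (bddAbove_PsiAux hprob h𝒳 hℓ M hL h₁) ⟨x, hx, rfl⟩
  · exact le_csSup (bddAbove_PsiAux hprob h𝒳 hℓ M hL h₂) ⟨x, hx, rfl⟩

lemma convex_setOf_isSymm : Convex ℝ {h : Matrix (Fin d) (Fin d) ℝ | h.IsSymm} :=
  fun _ h₁ _ h₂ _ _ _ _ _ => (Matrix.IsSymm.smul h₁ _).add (Matrix.IsSymm.smul h₂ _)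

end PsiAux

section PermutationAverage

variable {K : ℕ}

lemma Equiv.Perm.exists_map_pair {α : Type*} [DecidableEq α] {p q p' q' : α} (h : p ≠ q)
    (h' : p' ≠ q') : ∃ τ : Equiv.Perm α, τ p = p' ∧ τ q = q' := by
  have hne : p' ≠ Equiv.swap p p' q := fun e =>
    h ((Equiv.swap p p').injective ((Equiv.swap_apply_left p p').trans e))
  refine ⟨Equiv.swap (Equiv.swap p p' q) q' * Equiv.swap p p', ?_, ?_⟩
  · rw [Equiv.Perm.mul_apply, Equiv.swap_apply_left, Equiv.swap_apply_of_ne_of_ne hne h']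
  · rw [Equiv.Perm.mul_apply, Equiv.swap_apply_left]

/-- Averaging `g (σ p) (σ q)` over all permutations gives the off-diagonal average of `g`. -/
lemma sum_perm_eq_sum_offDiag (g : Fin K → Fin K → ℝ) {p q : Fin K} (hpq : p ≠ q) :
    (K : ℝ) * ((K : ℝ) - 1) * ∑ σ : Equiv.Perm (Fin K), g (σ p) (σ q)
      = (K.factorial : ℝ) * ∑ z ∈ (Finset.univ : Finset (Fin K)).offDiag, g z.1 z.2 := by
  have hconst : ∀ z ∈ (Finset.univ : Finset (Fin K)).offDiag,
      ∑ σ : Equiv.Perm (Fin K), g (σ z.1) (σ z.2)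
        = ∑ σ : Equiv.Perm (Fin K), g (σ p) (σ q) := fun z hz => by
    obtain ⟨τ, h₁, h₂⟩ := Equiv.Perm.exists_map_pair hpq (Finset.mem_offDiag.1 hz).2.2
    rw [← Equiv.sum_comp (Equiv.mulRight τ) fun σ : Equiv.Perm (Fin K) => g (σ p) (σ q)]
    simp [h₁, h₂]
  have hinv : ∀ σ : Equiv.Perm (Fin K),
      ∑ z ∈ (Finset.univ : Finset (Fin K)).offDiag, g (σ z.1) (σ z.2)
        = ∑ z ∈ (Finset.univ : Finset (Fin K)).offDiag, g z.1 z.2 := fun σ =>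
    Finset.sum_equiv (Equiv.prodCongr σ σ) (by simp [Finset.mem_offDiag]) (by simp)
  have hdouble := Finset.sum_congr rfl hconst
  rw [Finset.sum_comm, Finset.sum_congr rfl fun σ _ => hinv σ, Finset.sum_const,
    Finset.sum_const, Finset.offDiag_card, nsmul_eq_mul, nsmul_eq_mul, Finset.card_univ,
    Finset.card_univ, Fintype.card_perm, Fintype.card_fin,
    Nat.cast_sub (Nat.le_mul_self K)] at hdouble
  rw [hdouble]
  push_cast
  ring

lemma trace_mul_omegaLift {d : ℕ} (h : Matrix (Fin d) (Fin d) ℝ) (ζ : Fin K → Fin d → ℝ) :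
    (h * omegaLift ζ).trace = 1 / ((K : ℝ) * ((K : ℝ) - 1)) *
      ∑ z ∈ (Finset.univ : Finset (Fin K)).offDiag, ζ z.1 ⬝ᵥ h *ᵥ ζ z.2 := by
  have hpair : ∀ a b : Fin d → ℝ, (h * omegaPair a b).trace
      = 1 / 2 * (b ⬝ᵥ h *ᵥ a + a ⬝ᵥ h *ᵥ b) := fun a b => by
    simp only [omegaPair, Matrix.mul_smul, Matrix.mul_add, Matrix.trace_smul, Matrix.trace_add,
      Matrix.mul_vecMulVec, Matrix.trace_vecMulVec, smul_eq_mul, dotProduct_comm]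
  have hsplit : (Finset.univ : Finset (Fin K)).offDiag
      = Finset.univ.filter (fun z : Fin K × Fin K => z.1 < z.2)
        ∪ Finset.univ.filter (fun z : Fin K × Fin K => z.2 < z.1) := by
    ext z
    simp [Finset.mem_offDiag]
  have hdisj : Disjoint (Finset.univ.filter (fun z : Fin K × Fin K => z.1 < z.2))
      (Finset.univ.filter (fun z : Fin K × Fin K => z.2 < z.1)) :=
    Finset.disjoint_filter.2 fun z _ h₁ h₂ => lt_asymm h₁ h₂
  have hswap : ∑ z ∈ Finset.univ.filter (fun z : Fin K × Fin K => z.2 < z.1),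
      ζ z.1 ⬝ᵥ h *ᵥ ζ z.2
      = ∑ z ∈ Finset.univ.filter (fun z : Fin K × Fin K => z.1 < z.2),
      ζ z.2 ⬝ᵥ h *ᵥ ζ z.1 :=
    Finset.sum_equiv (Equiv.prodComm _ _) (by simp) (by simp)
  rw [hsplit, Finset.sum_union hdisj, hswap, omegaLift, Matrix.mul_smul, Matrix.trace_smul,
    Matrix.mul_sum, Matrix.trace_sum, smul_eq_mul, ← Finset.sum_add_distrib, Finset.mul_sum,
    Finset.mul_sum]
  refine Finset.sum_congr rfl fun z _ => ?_
  rw [hpair]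
  ring

/-- The `U`-statistic is the average over permutations of the means over disjoint pairs. -/
lemma trace_mul_omegaLift_eq_average {d M : ℕ} (hK : 2 ≤ K) (hM : 0 < M)
    {e : Fin M × Fin 2 → Fin K} (he : e.Injective) (h : Matrix (Fin d) (Fin d) ℝ)
    (ζ : Fin K → Fin d → ℝ) :
    (h * omegaLift ζ).trace = ∑ σ : Equiv.Perm (Fin K), (K.factorial : ℝ)⁻¹ *
      ((M : ℝ)⁻¹ * ∑ l, ζ (σ (e (l, 0))) ⬝ᵥ h *ᵥ ζ (σ (e (l, 1)))) := by
  have hK' : (2 : ℝ) ≤ K := by exact_mod_cast hK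
  have hKK : (K : ℝ) * ((K : ℝ) - 1) ≠ 0 := by
    have : (K : ℝ) - 1 ≠ 0 := by linarith
    have : (K : ℝ) ≠ 0 := by linarith
    positivity
  have hf : (K.factorial : ℝ) ≠ 0 := by positivity
  have hM' : (M : ℝ) ≠ 0 := by positivity
  have hl : ∀ l : Fin M, ∑ σ : Equiv.Perm (Fin K), ζ (σ (e (l, 0))) ⬝ᵥ h *ᵥ ζ (σ (e (l, 1)))
      = (K.factorial : ℝ) * (h * omegaLift ζ).trace := fun l => by
    have := sum_perm_eq_sum_offDiag (fun i j => ζ i ⬝ᵥ h *ᵥ ζ j)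
      (he.ne (by simp : ((l, 0) : Fin M × Fin 2) ≠ (l, 1)))
    rw [trace_mul_omegaLift]
    rw [eq_div_of_mul_eq hKK ((mul_comm _ _).trans this)]
    ring
  rw [← Finset.mul_sum, ← Finset.mul_sum, Finset.sum_comm, Finset.sum_congr rfl fun l _ => hl l]
  simp only [Finset.sum_const, Finset.card_univ, Fintype.card_fin, nsmul_eq_mul]
  field_simp

end PermutationAverage

section Tail

open ProbabilityTheory
open scoped ENNReal

lemma lintegral_discDist {d : ℕ} (μ : Fin d → ℝ) {f : (Fin d → ℝ) → ℝ≥0∞} (hf : Measurable f) :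
    ∫⁻ z, f z ∂discDist μ = ∑ i, ENNReal.ofReal (μ i) * f (Pi.single i 1) := by
  simp [discDist, lintegral_dirac' _ hf]

lemma isProbabilityMeasure_discDist {d : ℕ} {μ : Fin d → ℝ} (h0 : ∀ i, 0 ≤ μ i)
    (h1 : ∑ i, μ i = 1) : IsProbabilityMeasure (discDist μ) := by
  refine ⟨?_⟩
  simp [discDist, ← ENNReal.ofReal_sum_of_nonneg fun i _ => h0 i, h1]

lemma Measurable.comp_pair {κ E F : Type*} [MeasurableSpace E] [MeasurableSpace F] {f : E → E → F}
    (hf : Measurable (Function.uncurry f)) (a b : κ) :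
    Measurable fun ζ : κ → E => f (ζ a) (ζ b) :=
  Measurable.comp (g := Function.uncurry f) (f := fun ζ : κ → E => (ζ a, ζ b)) hf
    ((measurable_pi_apply a).prodMk (measurable_pi_apply b))

/-- Functions of disjoint pairs of coordinates are independent under a power measure. -/
lemma lintegral_pi_prod_pairs {κ ι E : Type*} [Fintype κ] [DecidableEq ι] [MeasurableSpace E]
    (P : Measure E) [IsProbabilityMeasure P] {e : ι × Fin 2 → κ} (he : e.Injective)
    {f : E → E → ℝ≥0∞} (hf : Measurable (Function.uncurry f)) (s : Finset ι) :
    ∫⁻ ζ, ∏ l ∈ s, f (ζ (e (l, 0))) (ζ (e (l, 1))) ∂(Measure.pi fun _ : κ => P)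
      = (∫⁻ x, ∫⁻ y, f x y ∂P ∂P) ^ s.card := by
  have hind : iIndepFun (fun k (ζ : κ → E) => ζ k) (Measure.pi fun _ : κ => P) :=
    iIndepFun_pi (X := fun _ => id) fun _ => aemeasurable_id
  have hinde : iIndepFun (fun k (ζ : κ → E) => ζ (e k)) (Measure.pi fun _ : κ => P) :=
    hind.precomp he
  have hmeas : ∀ l, Measurable fun ζ : κ → E => f (ζ (e (l, 0))) (ζ (e (l, 1))) := fun l =>
    hf.comp_pair _ _
  have hpair : ∀ l, ∫⁻ ζ, f (ζ (e (l, 0))) (ζ (e (l, 1))) ∂(Measure.pi fun _ : κ => P)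
      = ∫⁻ x, ∫⁻ y, f x y ∂P ∂P := fun l => by
    have hl := hinde.indepFun (by simp : ((l, 0) : ι × Fin 2) ≠ (l, 1))
    have hmap := hl.map_prod_eq_prod_map_map (measurable_pi_apply _).aemeasurable
      (measurable_pi_apply _).aemeasurable
    rw [(measurePreserving_eval (fun _ : κ => P) _).map_eq,
      (measurePreserving_eval (fun _ : κ => P) _).map_eq] at hmap
    have hfub := lintegral_prod (μ := P) (ν := P) (Function.uncurry f) hf.aemeasurable
    rw [← hmap, lintegral_map hf
      ((measurable_pi_apply _).prodMk (measurable_pi_apply _))] at hfub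
    exact hfub
  induction s using Finset.cons_induction with
  | empty => simp
  | cons j s hj ih =>
    have hdisj : Disjoint (({j} : Finset ι) ×ˢ (Finset.univ : Finset (Fin 2)))
        (s ×ˢ (Finset.univ : Finset (Fin 2))) := by
      rw [Finset.disjoint_product]
      exact Or.inl (Finset.disjoint_singleton_left.2 hj)
    have hST := hinde.indepFun_finset _ _ hdisj fun _ => measurable_pi_apply _
    have hφ : Measurable fun y : ↥(({j} : Finset ι) ×ˢ (Finset.univ : Finset (Fin 2))) → E =>
        f (y ⟨(j, 0), by simp⟩) (y ⟨(j, 1), by simp⟩) :=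
      hf.comp_pair _ _
    have hψ : Measurable fun y : ↥(s ×ˢ (Finset.univ : Finset (Fin 2))) → E =>
        ∏ l ∈ s.attach, f (y ⟨(l.1, 0), by simp⟩) (y ⟨(l.1, 1), by simp⟩) :=
      Finset.measurable_fun_prod _ fun l _ => hf.comp_pair _ _
    have hprod : (fun ζ : κ → E => ∏ l ∈ s, f (ζ (e (l, 0))) (ζ (e (l, 1))))
        = fun ζ => ∏ l ∈ s.attach, f (ζ (e (l.1, 0))) (ζ (e (l.1, 1))) :=
      funext fun ζ => (Finset.prod_attach s fun l => f (ζ (e (l, 0))) (ζ (e (l, 1)))).symm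
    have hcomp := hST.comp hφ hψ
    have hmul := lintegral_mul_eq_lintegral_mul_lintegral_of_indepFun''
      (hmeas j).aemeasurable
      (Finset.measurable_fun_prod s fun l _ => hmeas l).aemeasurable
      (by rw [hprod]; exact hcomp)
    simp_rw [Finset.prod_cons]
    rw [hmul, ih, hpair, Finset.card_cons, pow_succ']

lemma measurable_bilin {d : ℕ} (h : Matrix (Fin d) (Fin d) ℝ) :
    Measurable (Function.uncurry fun x y : Fin d → ℝ => x ⬝ᵥ h *ᵥ y) := by
  simp only [Function.uncurry_def, dotProduct, mulVec]
  fun_prop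

lemma measurable_trace_mul_omegaLift {d K : ℕ} (h : Matrix (Fin d) (Fin d) ℝ) :
    Measurable fun ζ : Fin K → Fin d → ℝ => (h * omegaLift ζ).trace := by
  simp_rw [trace_mul_omegaLift]
  refine Measurable.const_mul (Finset.measurable_fun_sum _ fun z _ => ?_) _
  exact (measurable_bilin h).comp_pair z.1 z.2

variable {d K : ℕ} {μ : Fin d → ℝ}

/-- The exponential tilt of a bilinear form `xᵀhy`, as an extended nonnegative function. -/
def expTilt (h : Matrix (Fin d) (Fin d) ℝ) (t β : ℝ) (x y : Fin d → ℝ) : ℝ≥0∞ :=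
  ENNReal.ofReal (exp ((x ⬝ᵥ h *ᵥ y - t) / β))

lemma measurable_expTilt (h : Matrix (Fin d) (Fin d) ℝ) (t β : ℝ) :
    Measurable (Function.uncurry (expTilt h t β)) :=
  (((measurable_bilin h).sub_const t).div_const β).exp.ennreal_ofReal

lemma lintegral_lintegral_expTilt (h0 : ∀ i, 0 ≤ μ i) (h : Matrix (Fin d) (Fin d) ℝ)
    (t β : ℝ) :
    ∫⁻ x, ∫⁻ y, expTilt h t β x y ∂discDist μ ∂discDist μ
      = ENNReal.ofReal (∑ i, ∑ j, vecMulVec μ μ i j * exp ((h i j - t) / β)) := by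
  have hterm : ∀ i j, 0 ≤ vecMulVec μ μ i j * exp ((h i j - t) / β) := fun i j =>
    mul_nonneg (mul_nonneg (h0 i) (h0 j)) (exp_pos _).le
  have hsingle : ∀ i j, expTilt h t β (Pi.single i 1) (Pi.single j 1)
      = ENNReal.ofReal (exp ((h i j - t) / β)) := fun i j => by simp [expTilt]
  have hinner : ∀ x, ∫⁻ y, expTilt h t β x y ∂discDist μ
      = ∑ j, ENNReal.ofReal (μ j) * expTilt h t β x (Pi.single j 1) := fun x =>
    lintegral_discDist μ (Measurable.of_uncurry_left (measurable_expTilt h t β))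
  have houter : Measurable fun x =>
      ∑ j, ENNReal.ofReal (μ j) * expTilt h t β x (Pi.single j 1) :=
    Finset.measurable_fun_sum _ fun j _ =>
      (Measurable.of_uncurry_right (measurable_expTilt h t β)).const_mul _
  simp_rw [hinner]
  rw [lintegral_discDist μ houter,
    ENNReal.ofReal_sum_of_nonneg fun i _ => Finset.sum_nonneg fun j _ => hterm i j]
  refine Finset.sum_congr rfl fun i _ => ?_
  rw [ENNReal.ofReal_sum_of_nonneg fun j _ => hterm i j, Finset.mul_sum]
  refine Finset.sum_congr rfl fun j _ => ?_
  rw [hsingle, ← ENNReal.ofReal_mul (h0 j), ← ENNReal.ofReal_mul (h0 i), ← mul_assoc,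
    vecMulVec_apply]

/-- Jensen's inequality for the exponential of the `U`-statistic. -/
lemma ofReal_exp_trace_le {M : ℕ} (hK : 2 ≤ K) (hM : 0 < M) {e : Fin M × Fin 2 → Fin K}
    (he : e.Injective) (h : Matrix (Fin d) (Fin d) ℝ) (t β : ℝ) (ζ : Fin K → Fin d → ℝ) :
    ENNReal.ofReal (exp (M / β * ((h * omegaLift ζ).trace - t)))
      ≤ ∑ σ : Equiv.Perm (Fin K), ENNReal.ofReal (K.factorial : ℝ)⁻¹ *
        ∏ l : Fin M, expTilt h t β (ζ (σ (e (l, 0)))) (ζ (σ (e (l, 1)))) := by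
  have hM' : (M : ℝ) ≠ 0 := by positivity
  have hfac : (0 : ℝ) < K.factorial := by positivity
  have hweights : ∑ _σ : Equiv.Perm (Fin K), (K.factorial : ℝ)⁻¹ = 1 := by
    simp [Finset.card_univ, Fintype.card_perm, hfac.ne']
  have hexp : M / β * ((h * omegaLift ζ).trace - t) = ∑ σ : Equiv.Perm (Fin K),
      (K.factorial : ℝ)⁻¹ •
        ∑ l : Fin M, (ζ (σ (e (l, 0))) ⬝ᵥ h *ᵥ ζ (σ (e (l, 1))) - t) / β := by
    rw [trace_mul_omegaLift_eq_average hK hM he h ζ]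
    nth_rewrite 1 [← one_mul t]
    rw [← hweights, Finset.sum_mul, ← Finset.sum_sub_distrib, Finset.mul_sum]
    refine Finset.sum_congr rfl fun σ _ => ?_
    rw [← Finset.sum_div, Finset.sum_sub_distrib]
    simp only [Finset.sum_const, Finset.card_univ, Fintype.card_fin, nsmul_eq_mul, smul_eq_mul]
    field_simp
  have hconv := convexOn_exp.map_sum_le (t := Finset.univ)
    (w := fun _ : Equiv.Perm (Fin K) => (K.factorial : ℝ)⁻¹)
    (p := fun σ => ∑ l : Fin M, (ζ (σ (e (l, 0))) ⬝ᵥ h *ᵥ ζ (σ (e (l, 1))) - t) / β)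
    (fun _ _ => by positivity) hweights (fun _ _ => Set.mem_univ _)
  rw [hexp]
  refine (ENNReal.ofReal_le_ofReal hconv).trans (le_of_eq ?_)
  rw [ENNReal.ofReal_sum_of_nonneg fun σ _ => by positivity]
  refine Finset.sum_congr rfl fun σ _ => ?_
  rw [smul_eq_mul, ENNReal.ofReal_mul (by positivity), exp_sum,
    ENNReal.ofReal_prod_of_nonneg fun l _ => (exp_pos _).le]
  rfl

/-- Chernoff bound for the `U`-statistic `Tr(h ω[ζ^K])`. -/
lemma measure_le_trace_le (hK : 2 ≤ K) (h0 : ∀ i, 0 ≤ μ i) (h1 : ∑ i, μ i = 1)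
    (h : Matrix (Fin d) (Fin d) ℝ) (t : ℝ) {β : ℝ} (hβ : 0 < β) :
    (Measure.pi fun _ : Fin K => discDist μ) {ζ | t ≤ (h * omegaLift ζ).trace}
      ≤ ENNReal.ofReal
        ((∑ i, ∑ j, vecMulVec μ μ i j * exp ((h i j - t) / β)) ^ (K / 2)) := by
  have := isProbabilityMeasure_discDist h0 h1
  set M := K / 2 with hMdef
  have hM : 0 < M := by omega
  have hM' : (0 : ℝ) < M := by exact_mod_cast hM
  obtain ⟨e, he⟩ : ∃ e : Fin M × Fin 2 → Fin K, e.Injective :=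
    ⟨Fin.castLE (Nat.div_mul_le_self K 2) ∘ finProdFinEquiv,
      (Fin.castLE_injective _).comp finProdFinEquiv.injective⟩
  have hf := measurable_expTilt h t β
  have hfac : (0 : ℝ) < K.factorial := by positivity
  have hweights : ∑ _σ : Equiv.Perm (Fin K), (K.factorial : ℝ)⁻¹ = 1 := by
    simp [Finset.card_univ, Fintype.card_perm, hfac.ne']
  have hmeas : ∀ σ : Equiv.Perm (Fin K), Measurable fun ζ : Fin K → Fin d → ℝ =>
      ∏ l : Fin M, expTilt h t β (ζ (σ (e (l, 0)))) (ζ (σ (e (l, 1)))) := fun σ =>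
    Finset.measurable_fun_prod _ fun l _ => hf.comp_pair _ _
  calc (Measure.pi fun _ : Fin K => discDist μ) {ζ | t ≤ (h * omegaLift ζ).trace}
      ≤ ∫⁻ ζ, ENNReal.ofReal (exp (M / β * ((h * omegaLift ζ).trace - t)))
          ∂(Measure.pi fun _ : Fin K => discDist μ) := by
        refine meas_le_lintegral₀ ?_ fun ζ hζ => ?_
        · exact (((measurable_trace_mul_omegaLift h).sub_const t).const_mul
            _).exp.ennreal_ofReal.aemeasurable
        · rw [← ENNReal.ofReal_one]
          refine ENNReal.ofReal_le_ofReal (one_le_exp ?_)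
          have : 0 ≤ (h * omegaLift ζ).trace - t := sub_nonneg.2 hζ
          positivity
    _ ≤ ∫⁻ ζ, ∑ σ : Equiv.Perm (Fin K), ENNReal.ofReal (K.factorial : ℝ)⁻¹ *
          ∏ l : Fin M, expTilt h t β (ζ (σ (e (l, 0)))) (ζ (σ (e (l, 1))))
          ∂(Measure.pi fun _ : Fin K => discDist μ) := 
        lintegral_mono (ofReal_exp_trace_le hK hM he h t β)
    _ = ∑ _σ : Equiv.Perm (Fin K), ENNReal.ofReal (K.factorial : ℝ)⁻¹ *
          ENNReal.ofReal
            ((∑ i, ∑ j, vecMulVec μ μ i j * exp ((h i j - t) / β)) ^ M) := by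
        rw [lintegral_finsetSum _ fun σ _ => (hmeas σ).const_mul _]
        refine Finset.sum_congr rfl fun σ _ => ?_
        rw [lintegral_const_mul _ (hmeas σ)]
        congr 1
        have := lintegral_pi_prod_pairs (discDist μ) (σ.injective.comp he) hf Finset.univ
        simp only [Function.comp_apply] at this
        rw [this, lintegral_lintegral_expTilt h0, Finset.card_univ, Fintype.card_fin, ENNReal.ofReal_pow]
        exact Finset.sum_nonneg fun i _ => Finset.sum_nonneg fun j _ =>
          mul_nonneg (mul_nonneg (h0 i) (h0 j)) (exp_pos _).le
    _ = ENNReal.ofReal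
          ((∑ i, ∑ j, vecMulVec μ μ i j * exp ((h i j - t) / β)) ^ M) := by
        rw [← Finset.sum_mul, ← ENNReal.ofReal_sum_of_nonneg fun _ _ => by positivity, hweights,
          ENNReal.ofReal_one, one_mul]

lemma isProbMatrix_vecMulVec (h0 : ∀ i, 0 ≤ μ i) (h1 : ∑ i, μ i = 1) :
    IsProbMatrix (vecMulVec μ μ) := by
  refine ⟨fun i j => mul_nonneg (h0 i) (h0 j), ?_⟩
  simp_rw [vecMulVec_apply, ← Finset.mul_sum, h1, mul_one, h1]

/-- The `U`-statistic exceeds the optimized Chernoff threshold with probability at most `e^{-L}`. -/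
lemma measure_sInf_tiltSet_lt_trace_le (hK : 2 ≤ K) (h0 : ∀ i, 0 ≤ μ i) (h1 : ∑ i, μ i = 1)
    (h : Matrix (Fin d) (Fin d) ℝ) (L r : ℝ) :
    (Measure.pi fun _ : Fin K => discDist μ)
        {ζ | sInf (tiltSet (K / 2) L r (vecMulVec μ μ) h) < (h * omegaLift ζ).trace + r}
      ≤ ENNReal.ofReal (exp (-L)) := by
  have hZ := isProbMatrix_vecMulVec h0 h1
  have hM' : (0 : ℝ) < (K / 2 : ℕ) := by
    have : 0 < K / 2 := by omega
    exact_mod_cast this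
  set s := sInf (tiltSet (K / 2) L r (vecMulVec μ μ) h) with hs
  have hattain : ∀ t ∈ tiltSet (K / 2) L r (vecMulVec μ μ) h,
      (Measure.pi fun _ : Fin K => discDist μ) {ζ | t ≤ (h * omegaLift ζ).trace + r}
        ≤ ENNReal.ofReal (exp (-L)) := by
    rintro _ ⟨β, hβ, rfl⟩
    set p := β * PhiD (β⁻¹ • h) (vecMulVec μ μ) with hp
    have hle := (hZ.mul_PhiD_le_iff (h := h) hβ).1 hp.ge
    have hset : {ζ : Fin K → Fin d → ℝ |
        p + r + β / (K / 2 : ℕ) * L ≤ (h * omegaLift ζ).trace + r}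
        = {ζ | p + β / (K / 2 : ℕ) * L ≤ (h * omegaLift ζ).trace} := by
      ext ζ
      simp only [Set.mem_ofPred_eq]
      constructor <;> intro _ <;> linarith
    rw [hset]
    refine (measure_le_trace_le hK h0 h1 h _ hβ).trans (ENNReal.ofReal_le_ofReal ?_)
    have hsum : ∑ i, ∑ j, vecMulVec μ μ i j * exp ((h i j - (p + β / (K / 2 : ℕ) * L)) / β)
        = (∑ i, ∑ j, vecMulVec μ μ i j * exp ((h i j - p) / β))
          * exp (-(L / (K / 2 : ℕ))) := by
      simp_rw [Finset.sum_mul, mul_assoc, ← exp_add]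
      refine Finset.sum_congr rfl fun i _ => Finset.sum_congr rfl fun j _ => ?_
      congr 2
      field_simp
      ring
    have hnn : 0 ≤ ∑ i, ∑ j, vecMulVec μ μ i j * exp ((h i j - p) / β) :=
      Finset.sum_nonneg fun i _ => Finset.sum_nonneg fun j _ =>
        mul_nonneg (hZ.1 i j) (exp_pos _).le
    rw [hsum, mul_pow, ← exp_nat_mul]
    have hexp : ((K / 2 : ℕ) : ℝ) * -(L / (K / 2 : ℕ)) = -L := by field_simp
    rw [hexp]
    exact mul_le_of_le_one_left (exp_pos _).le (pow_le_one₀ hnn hle)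
  have hunion : {ζ : Fin K → Fin d → ℝ | s < (h * omegaLift ζ).trace + r}
      = ⋃ n : ℕ, {ζ | s + 1 / ((n : ℝ) + 1) ≤ (h * omegaLift ζ).trace + r} := by
    ext ζ
    simp only [Set.mem_ofPred_eq, Set.mem_iUnion]
    constructor
    · intro hlt
      obtain ⟨n, hn⟩ := exists_nat_one_div_lt (sub_pos.2 hlt)
      exact ⟨n, by linarith⟩
    · rintro ⟨n, hn⟩
      have : (0 : ℝ) < 1 / ((n : ℝ) + 1) := by positivity
      linarith
  have hmono : Monotone fun n : ℕ =>
      {ζ : Fin K → Fin d → ℝ | s + 1 / ((n : ℝ) + 1) ≤ (h * omegaLift ζ).trace + r} :=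
    fun n k hnk ζ hζ => by
      have : 1 / ((k : ℝ) + 1) ≤ 1 / ((n : ℝ) + 1) := by gcongr
      simp only [Set.mem_ofPred_eq] at hζ ⊢
      linarith
  rw [hunion, hmono.measure_iUnion]
  refine iSup_le fun n => ?_
  obtain ⟨t, ht, htlt⟩ := exists_lt_of_csInf_lt (tiltSet_nonempty (K / 2) L r (vecMulVec μ μ) h)
    (lt_add_of_pos_right s (by positivity : (0 : ℝ) < 1 / ((n : ℝ) + 1)))
  exact (measure_mono fun ζ (hζ : _ ≤ _) => htlt.le.trans hζ).trans (hattain t ht)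

end Tail

/-- Proposition 5.4: estimation of a quadratic functional of a discrete
distribution. `Ψ̂₊`, `Ψ̂₋` are convex on `S^d`, and every `h̄ ∈ S^d` yields an estimate
`Tr(h̄·ω[ζ^K]) + κ(h̄)` of `F(u) = uᵀQ̄u` with ε-risk on `U` at most
`ρ̄ = (1/2)(Ψ̂₊(h̄)+Ψ̂₋(h̄))`. -/
theorem statement19 {d m : ℕ}
    (A : Matrix (Fin d) (Fin m) ℝ)
    (hA0 : ∀ i j, 0 ≤ A i j) (hA1 : ∀ j, ∑ i, A i j = 1)
    (U : Set (Fin m → ℝ)) (hUne : U.Nonempty) (hUcl : IsClosed U)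
    (hUΔ : ∀ u ∈ U, (∀ i, 0 ≤ u i) ∧ ∑ i, u i = 1)
    (Q : Matrix (Fin m) (Fin m) ℝ) (hQsym : Q.IsSymm) (q : Fin m → ℝ)
    (Qbar : Matrix (Fin m) (Fin m) ℝ)
    (hQbar : Qbar = Q + vecMulVec q (fun _ => 1) + vecMulVec (fun _ => 1) q)
    (𝒳 : Set (Matrix (Fin m) (Fin m) ℝ)) (h𝒳conv : Convex ℝ 𝒳) (h𝒳cpt : IsCompact 𝒳)
    (h𝒳sub : ∀ x ∈ 𝒳, (∀ i j, 0 ≤ x i j) ∧ (∑ i, ∑ j, x i j) = 1 ∧ x.PosSemidef)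
    (h𝒳U : ∀ u ∈ U, vecMulVec u u ∈ 𝒳)
    (K : ℕ) (hK : 2 ≤ K) (ε : ℝ) (hε0 : 0 < ε) (hε1 : ε < 1) :
    ConvexOn ℝ {h : Matrix (Fin d) (Fin d) ℝ | h.IsSymm}
      (PsiDQPlus 𝒳 A Qbar (K / 2) ε) ∧
    ConvexOn ℝ {h : Matrix (Fin d) (Fin d) ℝ | h.IsSymm}
      (PsiDQMinus 𝒳 A Qbar (K / 2) ε) ∧
    ∀ (hbar : Matrix (Fin d) (Fin d) ℝ), hbar.IsSymm →
      ∀ (κ ρbar : ℝ),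
        κ = (1/2) * (PsiDQMinus 𝒳 A Qbar (K / 2) ε hbar
              - PsiDQPlus 𝒳 A Qbar (K / 2) ε hbar) →
        ρbar = (1/2) * (PsiDQPlus 𝒳 A Qbar (K / 2) ε hbar
              + PsiDQMinus 𝒳 A Qbar (K / 2) ε hbar) →
        ∀ u ∈ U,
          (Measure.pi fun _ : Fin K => discDist (A.mulVec u))
              {ζ | ρbar < |u ⬝ᵥ Qbar.mulVec u - ((hbar * omegaLift ζ).trace + κ)|}
            ≤ ENNReal.ofReal ε := by
  have hL : 0 ≤ Real.log (2 / ε) := Real.log_nonneg (by rw [le_div_iff₀ hε0]; linarith)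
  have hprob : ∀ x ∈ 𝒳, IsProbMatrix (A * x * Aᵀ) := fun x hx =>
    isProbMatrix_conj hA0 hA1 (h𝒳sub x hx).1 (h𝒳sub x hx).2.1
  have hne : 𝒳.Nonempty := hUne.imp' (fun u => vecMulVec u u) h𝒳U
  have htr : Continuous fun x : Matrix (Fin m) (Fin m) ℝ => (Qbar * x).trace :=
    (continuous_const.mul continuous_id).matrix_trace
  have hplus := convexOn_PsiAux hprob h𝒳cpt hne htr.neg (K / 2) hL
  have hminus := convexOn_PsiAux hprob h𝒳cpt hne htr (K / 2) hL
  refine ⟨?_, ?_, ?_⟩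
  · refine (hplus.subset (Set.subset_univ _) convex_setOf_isSymm).congr fun h _ => ?_
    rw [PsiDQPlus_eq_PsiAux]
    rfl
  · refine ((hminus.comp_linearMap (-LinearMap.id)).subset (Set.subset_univ _)
      convex_setOf_isSymm).congr fun h _ => ?_
    rw [PsiDQMinus_eq_PsiAux]
    rfl
  rintro h - κ ρ hκ hρ u hu
  rw [PsiDQPlus_eq_PsiAux, PsiDQMinus_eq_PsiAux] at hκ hρ
  set μ := A.mulVec u with hμ
  obtain ⟨hu0, hu1⟩ := hUΔ u hu
  have h0 : ∀ i, 0 ≤ μ i := fun i => by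
    rw [hμ, mulVec, dotProduct]
    exact Finset.sum_nonneg fun j _ => mul_nonneg (hA0 i j) (hu0 j)
  have h1 : ∑ i, μ i = 1 := by
    simp only [hμ, mulVec, dotProduct]
    rw [Finset.sum_comm]
    simp_rw [← Finset.sum_mul, hA1, one_mul, hu1]
  have hZ : A * vecMulVec u u * Aᵀ = vecMulVec μ μ := by
    rw [Matrix.mul_vecMulVec, Matrix.vecMulVec_mul, vecMul_transpose]
  have hF : (Qbar * vecMulVec u u).trace = u ⬝ᵥ Qbar *ᵥ u := by
    rw [Matrix.mul_vecMulVec, Matrix.trace_vecMulVec, dotProduct_comm]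
  have hle₁ : _ ≤ PsiAux 𝒳 A (fun x => -(Qbar * x).trace) (K / 2) (Real.log (2 / ε)) h :=
    le_csSup (bddAbove_PsiAux hprob h𝒳cpt htr.neg (K / 2) hL h) ⟨_, h𝒳U u hu, rfl⟩
  have hle₂ : _ ≤ PsiAux 𝒳 A (fun x => (Qbar * x).trace) (K / 2) (Real.log (2 / ε)) (-h) :=
    le_csSup (bddAbove_PsiAux hprob h𝒳cpt htr (K / 2) hL (-h)) ⟨_, h𝒳U u hu, rfl⟩
  simp only [hZ, hF] at hle₁ hle₂
  have hexp : exp (-Real.log (2 / ε)) = ε / 2 := by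
    rw [← Real.log_inv, inv_div, exp_log (by positivity)]
  have htail₁ := measure_sInf_tiltSet_lt_trace_le hK h0 h1 h (Real.log (2 / ε))
    (-(u ⬝ᵥ Qbar *ᵥ u))
  have htail₂ := measure_sInf_tiltSet_lt_trace_le hK h0 h1 (-h) (Real.log (2 / ε))
    (u ⬝ᵥ Qbar *ᵥ u)
  rw [hexp] at htail₁ htail₂
  calc _ ≤ _ := measure_mono ?_
    _ ≤ _ := measure_union_le _ _
    _ ≤ _ := add_le_add htail₁ htail₂
    _ = ENNReal.ofReal ε := by
      rw [← ENNReal.ofReal_add (by positivity) (by positivity), add_halves]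
  intro ζ hζ
  rw [Set.mem_ofPred_eq, lt_abs] at hζ
  rcases hζ with hζ | hζ
  · right
    rw [Set.mem_ofPred_eq, Matrix.neg_mul, Matrix.trace_neg]
    linarith
  · left
    rw [Set.mem_ofPred_eq]
    linarith

end
end
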